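/- Define w : ℝ^N → ℝ by w(x) = sup{v(x) : v is a subsolution of H = 0 such that ∫ v(x) dμ(x,q) ≤ 0 for every Mather measure μ} (every Mather measure is compactly supported, so these integrals are well defined). Then, as λ → 0⁺, the maximal subsolutions u_λ of the discounted equations converge to w locally uniformly on ℝ^N. -/

import Mathlib

open MeasureTheory Set
open scoped RealInnerProductSpace

noncomputable section

abbrev Euc (N : ℕ) := EuclideanSpace ℝ (Fin N)

/-- `u` is an (a.e.) subsolution of `H = a` in `ℝ^N`. -/
def IsSubsol {N : ℕ} (H : Euc N × Euc N → ℝ) (a : ℝ) (u : Euc N → ℝ) : Prop :=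
  LocallyLipschitz u ∧
    ∀ᵐ x : Euc N ∂volume, DifferentiableAt ℝ u x → H (x, gradient u x) ≤ a

/-- `u` is an (a.e.) subsolution of the discounted equation `λ u + H(x,Du) = 0`. -/
def IsDiscSubsol {N : ℕ} (H : Euc N × Euc N → ℝ) (lam : ℝ) (u : Euc N → ℝ) : Prop :=
  LocallyLipschitz u ∧
    ∀ᵐ x : Euc N ∂volume, DifferentiableAt ℝ u x →
      lam * u x + H (x, gradient u x) ≤ 0

/-- The Lagrangian associated with `H` via the Fenchel transform. -/
def Lag {N : ℕ} (H : Euc N × Euc N → ℝ) : Euc N × Euc N → ℝ :=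
  fun z => sSup (Set.range fun p : Euc N => ⟪p, z.2⟫ - H (z.1, p))

/-- `u` is a subsolution for the generalized Lagrangian `Φ`. -/
def SubsolFor {N : ℕ} (Φ : Euc N × Euc N → ℝ) (u : Euc N → ℝ) : Prop :=
  LocallyLipschitz u ∧
    ∀ᵐ x : Euc N ∂volume, DifferentiableAt ℝ u x →
      ∀ q : Euc N, fderiv ℝ u x q ≤ Φ (x, q)

/-- `u` is a `λ`-discounted subsolution for the generalized Lagrangian `Φ`. -/
def DiscSubsolFor {N : ℕ} (lam : ℝ) (Φ : Euc N × Euc N → ℝ) (u : Euc N → ℝ) : Prop :=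
  LocallyLipschitz u ∧
    ∀ᵐ x : Euc N ∂volume, DifferentiableAt ℝ u x →
      ∀ q : Euc N, lam * u x + fderiv ℝ u x q ≤ Φ (x, q)

/-- A Mather measure for the ergodic problem. -/
def MatherMeasure {N : ℕ} (H : Euc N × Euc N → ℝ) (μ : Measure (Euc N × Euc N)) : Prop :=
  IsProbabilityMeasure μ ∧ Integrable (Lag H) μ ∧ (∫ z, Lag H z ∂μ) = 0 ∧
    ∀ Φ : Euc N × Euc N → ℝ, Continuous Φ → BddBelow (Set.range Φ) →
      (∃ u, SubsolFor Φ u) → (Integrable Φ μ → 0 ≤ ∫ z, Φ z ∂μ)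

/-- A `(λ,z)`-Mather measure (relative to the maximal discounted solution `um`). -/
def DiscMatherMeasure {N : ℕ} (H : Euc N × Euc N → ℝ) (lam : ℝ) (z : Euc N)
    (um : Euc N → ℝ) (μ : Measure (Euc N × Euc N)) : Prop :=
  IsProbabilityMeasure μ ∧ Integrable (Lag H) μ ∧ (∫ w, Lag H w ∂μ) = lam * um z ∧
    ∀ Φ : Euc N × Euc N → ℝ, Continuous Φ → BddBelow (Set.range Φ) →
      ∀ u : Euc N → ℝ, DiscSubsolFor lam Φ u →
        (Integrable Φ μ → lam * u z ≤ ∫ w, Φ w ∂μ)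

open Filter Topology

/-- **Rademacher theorem** for locally Lipschitz functions. -/
theorem LocallyLipschitz.ae_differentiableAt_euc {N : ℕ} {u : Euc N → ℝ}
    (hu : LocallyLipschitz u) : ∀ᵐ x : Euc N, DifferentiableAt ℝ u x := by
  have key : ∀ n : ℕ, ∀ᵐ x : Euc N, x ∈ Metric.ball (0 : Euc N) n → DifferentiableAt ℝ u x := by
    intro n
    obtain ⟨K, hK⟩ := (hu.locallyLipschitzOn (s := Metric.closedBall (0 : Euc N) n)
      ).exists_lipschitzOnWith_of_compact (isCompact_closedBall _ _)
    filter_upwards [(hK.mono Metric.ball_subset_closedBall).ae_differentiableWithinAt_of_mem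
      (μ := volume)] with x hx hxn
    exact (hx hxn).differentiableAt (Metric.isOpen_ball.mem_nhds hxn)
  filter_upwards [ae_all_iff.2 key] with x hx
  obtain ⟨n, hn⟩ := exists_nat_gt ‖x‖
  exact hx n (by simpa using hn)

theorem LocallyLipschitz.const_mul_real {N : ℕ} {u : Euc N → ℝ} (hu : LocallyLipschitz u)
    (c : ℝ) : LocallyLipschitz fun x => c * u x :=
  (LipschitzWith.locallyLipschitz (lipschitzWith_smul c)).comp hu

/-- A function with a one-sided bound on its derivative along `q`, almost everywhere on an open
neighbourhood of a segment of direction `q`, satisfies the corresponding increment bound. -/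
theorem LocallyLipschitz.segment_le {N : ℕ} {u : Euc N → ℝ} (hu : LocallyLipschitz u)
    {U : Set (Euc N)} (hU : IsOpen U) {x q : Euc N} {t C : ℝ} (ht : 0 ≤ t)
    (hseg : ∀ s ∈ Icc 0 t, x + s • q ∈ U)
    (hae : ∀ᵐ y : Euc N, y ∈ U → DifferentiableAt ℝ u y → fderiv ℝ u y q ≤ C) :
    u (x + t • q) ≤ u x + t * C := by
  have hgood : ∀ᵐ y : Euc N, ∀ᵐ s : ℝ, DifferentiableAt ℝ u (y + s • q) ∧
      (y + s • q ∈ U → fderiv ℝ u (y + s • q) q ≤ C) := by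
    have h1 : ∀ᵐ y : Euc N, DifferentiableAt ℝ u y ∧ (y ∈ U → fderiv ℝ u y q ≤ C) := by
      filter_upwards [hae, hu.ae_differentiableAt_euc] with y h1 h2
      exact ⟨h2, fun h => h1 h h2⟩
    obtain ⟨B, hBsub, hBm, hB0⟩ := exists_measurable_superset_of_null (ae_iff.1 h1)
    have hmeas : MeasurableSet {z : ℝ × Euc N | z.2 + z.1 • q ∈ B} :=
      hBm.preimage (by fun_prop)
    have h2 : ∀ᵐ y : Euc N, ∀ᵐ s : ℝ, y + s • q ∉ B := by
      refine Measure.ae_ae_comm (μ := (volume : Measure ℝ)) (ν := (volume : Measure (Euc N)))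
        (p := fun s y => y + s • q ∉ B) hmeas.compl |>.1 ?_
      refine Eventually.of_forall fun s => ?_
      rw [ae_iff]
      simp only [not_not]
      have := (measure_preimage_add_right (volume : Measure (Euc N)) (s • q) B)
      rw [hB0] at this
      exact this
    filter_upwards [h2] with y hy
    filter_upwards [hy] with s hs
    by_contra hcon
    exact hs (hBsub hcon)
  have hnear : ∀ᶠ y in 𝓝 x, ∀ s ∈ Icc 0 t, y + s • q ∈ U := by
    refine isCompact_Icc.eventually_forall_of_forall_eventually fun s hs => ?_
    have hc : Continuous fun z : Euc N × ℝ => z.1 + z.2 • q := by fun_prop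
    exact hc.continuousAt.eventually (hU.mem_nhds (hseg s hs))
  have hfreq : ∃ᶠ y in 𝓝 x, u (y + t • q) ≤ u y + t * C := by
    have hd : ∃ᶠ y in 𝓝 x, ∀ᵐ s : ℝ, DifferentiableAt ℝ u (y + s • q) ∧
        (y + s • q ∈ U → fderiv ℝ u (y + s • q) q ≤ C) :=
      mem_closure_iff_frequently.1 (Measure.dense_of_ae hgood x)
    refine (hd.and_eventually hnear).mono ?_
    rintro y ⟨hy, hyU⟩
    set f : ℝ → ℝ := fun s => u (y + s • q) with hf
    have hfl : LocallyLipschitz f := by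
      refine hu.comp ?_
      have : ContDiff ℝ 1 fun s : ℝ => y + s • q := by fun_prop
      exact this.locallyLipschitz
    obtain ⟨K, hK⟩ := (hfl.locallyLipschitzOn (s := uIcc 0 t)).exists_lipschitzOnWith_of_compact
      isCompact_uIcc
    have hac := hK.absolutelyContinuousOnInterval
    have hintg := hac.integral_deriv_eq_sub
    have hle : ∫ s in (0 : ℝ)..t, deriv f s ≤ ∫ _ in (0 : ℝ)..t, C := by
      refine intervalIntegral.integral_mono_ae_restrict ht hac.intervalIntegrable_deriv (by simp) ?_
      filter_upwards [ae_restrict_of_ae hy, ae_restrict_mem measurableSet_Icc] with s hs hst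
      have hline : HasDerivAt (fun s : ℝ => y + s • q) q s := by
        simpa using ((hasDerivAt_id s).smul_const q).const_add y
      have := hs.1.hasFDerivAt.comp_hasDerivAt s hline
      have h3 : deriv f s = fderiv ℝ u (y + s • q) q := this.deriv
      rw [h3]
      exact hs.2 (hyU s hst)
    rw [hintg] at hle
    simp [hf] at hle
    linarith
  by_contra hcon
  rw [not_le] at hcon
  have hev : ∀ᶠ y in 𝓝 x, u y + t * C < u (y + t • q) := by
    have := hu.continuous
    refine Tendsto.eventually_lt (f := fun y => u y + t * C) (g := fun y => u (y + t • q)) ?_ ?_ hcon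
    · exact (this.add continuous_const).continuousAt
    · exact (show Continuous fun y => u (y + t • q) by fun_prop).continuousAt
  obtain ⟨y, h1, h2⟩ := (hfreq.and_eventually hev).exists
  linarith

theorem fderiv_eq_of_touching {E : Type*} [NormedAddCommGroup E] [NormedSpace ℝ E]
    {f g : E → ℝ} {x : E} (hf : DifferentiableAt ℝ f x) (hg : DifferentiableAt ℝ g x)
    (hle : ∀ y, f y ≤ g y) (heq : f x = g x) : fderiv ℝ f x = fderiv ℝ g x := by
  have hmin : IsLocalMin (fun y => g y - f y) x :=
    Eventually.of_forall fun y => by simp [heq, hle y]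
  have h0 := hmin.fderiv_eq_zero
  rw [fderiv_fun_sub hg hf, sub_eq_zero] at h0
  exact h0.symm

theorem gradient_eq_of_touching {N : ℕ} {f g : Euc N → ℝ} {x : Euc N}
    (hf : DifferentiableAt ℝ f x) (hg : DifferentiableAt ℝ g x)
    (hle : ∀ y, f y ≤ g y) (heq : f x = g x) : gradient f x = gradient g x := by
  simp only [gradient, fderiv_eq_of_touching hf hg hle heq]

theorem gradient_max {N : ℕ} {f g : Euc N → ℝ} {x : Euc N}
    (hf : DifferentiableAt ℝ f x) (hg : DifferentiableAt ℝ g x)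
    (hm : DifferentiableAt ℝ (fun y => max (f y) (g y)) x) :
    (g x ≤ f x ∧ gradient (fun y => max (f y) (g y)) x = gradient f x) ∨
      (f x ≤ g x ∧ gradient (fun y => max (f y) (g y)) x = gradient g x) := by
  rcases le_total (g x) (f x) with h | h
  · exact Or.inl ⟨h, (gradient_eq_of_touching hf hm (fun y => le_max_left _ _)
      (max_eq_left h).symm).symm⟩
  · exact Or.inr ⟨h, (gradient_eq_of_touching hg hm (fun y => le_max_right _ _)
      (max_eq_right h).symm).symm⟩

theorem gradient_min {N : ℕ} {f g : Euc N → ℝ} {x : Euc N}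
    (hf : DifferentiableAt ℝ f x) (hg : DifferentiableAt ℝ g x)
    (hm : DifferentiableAt ℝ (fun y => min (f y) (g y)) x) :
    (f x ≤ g x ∧ gradient (fun y => min (f y) (g y)) x = gradient f x) ∨
      (g x ≤ f x ∧ gradient (fun y => min (f y) (g y)) x = gradient g x) := by
  rcases le_total (f x) (g x) with h | h
  · exact Or.inl ⟨h, gradient_eq_of_touching hm hf (fun y => min_le_left _ _) (min_eq_left h)⟩
  · exact Or.inr ⟨h, gradient_eq_of_touching hm hg (fun y => min_le_right _ _) (min_eq_right h)⟩

theorem inner_gradient {N : ℕ} (u : Euc N → ℝ) (x q : Euc N) :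
    ⟪gradient u x, q⟫ = fderiv ℝ u x q := by
  simp [gradient]

/-- A continuous convex function on a real inner product space has a subgradient at every point. -/
theorem ConvexOn.exists_subgradient {E : Type*} [NormedAddCommGroup E] [InnerProductSpace ℝ E]
    [CompleteSpace E] {f : E → ℝ} (hf : ConvexOn ℝ univ f) (hc : Continuous f) (p : E) :
    ∃ q : E, ∀ p' : E, f p + ⟪p' - p, q⟫ ≤ f p' := by
  have hconv : Convex ℝ {z : E × ℝ | f z.1 < z.2} := by
    simpa using hf.convex_strict_epigraph
  have hopen : IsOpen {z : E × ℝ | f z.1 < z.2} :=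
    isOpen_lt (hc.comp continuous_fst) continuous_snd
  obtain ⟨F, hF⟩ := geometric_hahn_banach_open_point (x := (p, f p)) hconv hopen (by simp)
  set c : ℝ := F (0, 1) with hcdef
  have hdec : ∀ (a : E) (b : ℝ), F (a, b) = F (a, 0) + b * c := by
    intro a b
    have : ((a, b) : E × ℝ) = (a, 0) + b • ((0, 1) : E × ℝ) := by simp
    rw [this, map_add, map_smul, smul_eq_mul]
  have hcneg : c < 0 := by
    have := hF (p, f p + 1) (by simp)
    rw [hdec, hdec p (f p)] at this
    linarith
  have hle : ∀ p' : E, F (p', 0) + f p' * c ≤ F (p, 0) + f p * c := by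
    intro p'
    have h : ∀ η > (0 : ℝ), F (p', 0) + f p' * c + η * c < F (p, 0) + f p * c := by
      intro η hη
      have := hF (p', f p' + η) (by simpa using hη)
      rw [hdec, hdec p (f p)] at this
      linarith
    have hlim : Tendsto (fun η : ℝ => F (p', 0) + f p' * c + η * c) (𝓝[>] 0)
        (𝓝 (F (p', 0) + f p' * c + 0 * c)) :=
      (Continuous.tendsto (by fun_prop) 0).mono_left nhdsWithin_le_nhds
    have := le_of_tendsto hlim (by
      filter_upwards [self_mem_nhdsWithin] with η hη using (h η hη).le)
    simpa using this
  set G : StrongDual ℝ E := F.comp (ContinuousLinearMap.inl ℝ E ℝ) with hG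
  refine ⟨(-c)⁻¹ • (InnerProductSpace.toDual ℝ E).symm G, fun p' => ?_⟩
  have h1 : ⟪p' - p, (InnerProductSpace.toDual ℝ E).symm G⟫ = F (p', 0) - F (p, 0) := by
    rw [real_inner_comm, InnerProductSpace.toDual_symm_apply, map_sub]
    simp [hG]
  rw [inner_smul_right, h1]
  have h2 := hle p'
  have h3 : (-c)⁻¹ * (F (p', 0) - F (p, 0)) ≤ f p' - f p := by
    rw [inv_mul_le_iff₀ (by linarith)]
    linarith
  linarith

/-- Standing assumptions on a Hamiltonian: continuity, convexity and superlinearity in `p`. -/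
structure IsTonelli {N : ℕ} (H : Euc N × Euc N → ℝ) : Prop where
  continuous : Continuous H
  convex : ∀ x : Euc N, ConvexOn ℝ Set.univ fun p => H (x, p)
  superlinear : ∀ x : Euc N, ∀ C : ℝ, ∃ r : ℝ, ∀ p : Euc N, r ≤ ‖p‖ → C * ‖p‖ ≤ H (x, p)

namespace IsTonelli

variable {N : ℕ} {H : Euc N × Euc N → ℝ}

theorem exists_superlinear_nhds (hH : IsTonelli H) (C : ℝ) (x₀ : Euc N) :
    ∃ r : ℝ, ∀ᶠ x in 𝓝 x₀, ∀ p : Euc N, r ≤ ‖p‖ → C * ‖p‖ ≤ H (x, p) := by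
  obtain ⟨r₀, hr₀⟩ := hH.superlinear x₀ (C + 1)
  have hcont := hH.continuous
  set M : ℝ := |H (x₀, 0)| + 1 with hM
  have hMpos : 0 < M := by positivity
  set r : ℝ := max r₀ (M + 1) with hr
  have hrpos : 0 < r := lt_max_of_lt_right (by linarith)
  have h1 : ∀ᶠ x in 𝓝 x₀, H (x, 0) < M := by
    refine (show Continuous fun x => H (x, 0) by fun_prop).continuousAt.eventually_lt_const ?_
    have := le_abs_self (H (x₀, 0))
    linarith
  have h2 : ∀ᶠ x in 𝓝 x₀, ∀ p ∈ Metric.sphere (0 : Euc N) r, (C + 1) * r - 1 < H (x, p) := by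
    refine (isCompact_sphere _ _).eventually_forall_of_forall_eventually fun p hp => ?_
    have hpr : ‖p‖ = r := by simpa using hp
    refine hcont.continuousAt.eventually_const_lt ?_
    have := hr₀ p (by rw [hpr]; exact le_max_left _ _)
    rw [hpr] at this
    linarith
  refine ⟨r, ?_⟩
  filter_upwards [h1, h2] with x hx1 hx2 p hp
  have hppos : 0 < ‖p‖ := hrpos.trans_le hp
  have hτ : r / ‖p‖ ≤ 1 := (div_le_one hppos).2 hp
  have hτ0 : 0 < r / ‖p‖ := by positivity
  have hs := hx2 ((r / ‖p‖) • p) (by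
    simp [norm_smul, abs_of_pos hrpos, hppos.ne'])
  have hcv := (hH.convex x).2 (mem_univ p) (mem_univ 0) hτ0.le (sub_nonneg.2 hτ) (by ring)
  simp only [smul_zero, add_zero, smul_eq_mul] at hcv
  have h3 : (1 - r / ‖p‖) * H (x, 0) ≤ M := by
    rcases le_total (H (x, 0)) 0 with h | h
    · nlinarith
    · nlinarith
  have hrM : M + 1 ≤ r := le_max_right _ _
  have h4 : C * r ≤ (r / ‖p‖) * H (x, p) := by linarith
  rw [div_mul_eq_mul_div, le_div_iff₀ hppos] at h4
  have h5 : r * (C * ‖p‖) ≤ r * H (x, p) := by linarith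
  exact le_of_mul_le_mul_left h5 hrpos

theorem exists_superlinear (hH : IsTonelli H) (R C : ℝ) :
    ∃ r : ℝ, ∀ x : Euc N, ‖x‖ ≤ R → ∀ p : Euc N, r ≤ ‖p‖ → C * ‖p‖ ≤ H (x, p) := by
  suffices h : ∃ r : ℝ, ∀ x ∈ Metric.closedBall (0 : Euc N) R,
      ∀ p : Euc N, r ≤ ‖p‖ → C * ‖p‖ ≤ H (x, p) by
    simpa using h
  refine (isCompact_closedBall (0 : Euc N) R).induction_on
    (p := fun S => ∃ r : ℝ, ∀ x ∈ S, ∀ p : Euc N, r ≤ ‖p‖ → C * ‖p‖ ≤ H (x, p)) ?_ ?_ ?_ ?_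
  · simp
  · rintro s t hst ⟨r, hr⟩
    exact ⟨r, fun x hx => hr x (hst hx)⟩
  · rintro s t ⟨r, hr⟩ ⟨r', hr'⟩
    refine ⟨max r r', fun x hx p hp => ?_⟩
    rcases hx with hx | hx
    · exact hr x hx p ((le_max_left _ _).trans hp)
    · exact hr' x hx p ((le_max_right _ _).trans hp)
  · intro x _
    obtain ⟨r, hr⟩ := hH.exists_superlinear_nhds C x
    exact ⟨_, mem_nhdsWithin_of_mem_nhds hr, r, fun y hy => hy⟩

theorem exists_bound (hH : IsTonelli H) (R P : ℝ) :
    ∃ M : ℝ, ∀ x p : Euc N, ‖x‖ ≤ R → ‖p‖ ≤ P → |H (x, p)| ≤ M := by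
  obtain ⟨M, hM⟩ := ((isCompact_closedBall (0 : Euc N) R).prod
    (isCompact_closedBall (0 : Euc N) P)).exists_bound_of_continuousOn hH.continuous.continuousOn
  exact ⟨M, fun x p hx hp => hM (x, p) (by simp [hx, hp])⟩

/-- For `(x, q)` in a bounded set, the supremum defining the Lagrangian may be restricted to a fixed
ball. -/
theorem exists_le_on_ball (hH : IsTonelli H) (R Q : ℝ) :
    ∃ r : ℝ, 0 ≤ r ∧ ∀ x q : Euc N, ‖x‖ ≤ R → ‖q‖ ≤ Q → ∀ p : Euc N, ∃ p' : Euc N, ‖p'‖ ≤ r ∧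
      ⟪p, q⟫ - H (x, p) ≤ ⟪p', q⟫ - H (x, p') := by
  obtain ⟨r, hr⟩ := hH.exists_superlinear R (Q + 1)
  obtain ⟨M, hM⟩ := hH.exists_bound R 0
  refine ⟨max (max r M) 0, le_max_right _ _, fun x q hx hq p => ?_⟩
  rcases le_total ‖p‖ (max (max r M) 0) with h | h
  · exact ⟨p, h, le_rfl⟩
  · refine ⟨0, by simp, ?_⟩
    have hrp : r ≤ ‖p‖ := ((le_max_left _ _).trans (le_max_left _ _)).trans h
    have hMp : M ≤ ‖p‖ := ((le_max_right _ _).trans (le_max_left _ _)).trans h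
    have h1 := hr x hx p hrp
    have h2 := (abs_le.1 (hM x 0 hx (by simp))).2
    have h3 : ⟪p, q⟫ ≤ ‖p‖ * ‖q‖ := real_inner_le_norm p q
    have h4 : ‖p‖ * ‖q‖ ≤ ‖p‖ * Q := mul_le_mul_of_nonneg_left hq (norm_nonneg _)
    simp only [inner_zero_left]
    linarith

theorem bddAbove_range (hH : IsTonelli H) (x q : Euc N) :
    BddAbove (range fun p : Euc N => ⟪p, q⟫ - H (x, p)) := by
  obtain ⟨r, -, hr⟩ := hH.exists_le_on_ball ‖x‖ ‖q‖
  obtain ⟨M, hM⟩ := hH.exists_bound ‖x‖ r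
  refine ⟨r * ‖q‖ + M, ?_⟩
  rintro _ ⟨p, rfl⟩
  obtain ⟨p', hp', hle⟩ := hr x q le_rfl le_rfl p
  have h1 := (abs_le.1 (hM x p' le_rfl hp')).1
  have h3 : ⟪p', q⟫ ≤ ‖p'‖ * ‖q‖ := real_inner_le_norm p' q
  have h4 : ‖p'‖ * ‖q‖ ≤ r * ‖q‖ := mul_le_mul_of_nonneg_right hp' (norm_nonneg _)
  simp only
  linarith

/-- The Fenchel–Young inequality. -/
theorem inner_le (hH : IsTonelli H) (x p q : Euc N) : ⟪p, q⟫ ≤ Lag H (x, q) + H (x, p) := by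
  have : ⟪p, q⟫ - H (x, p) ≤ Lag H (x, q) := le_csSup (hH.bddAbove_range x q) ⟨p, rfl⟩
  linarith

theorem lag_le (x q : Euc N) {C : ℝ} (h : ∀ p : Euc N, ⟪p, q⟫ - H (x, p) ≤ C) :
    Lag H (x, q) ≤ C :=
  csSup_le (range_nonempty _) (by rintro _ ⟨p, rfl⟩; exact h p)

theorem continuous_lag (hH : IsTonelli H) : Continuous (Lag H) := by
  rw [continuous_iff_continuousAt]
  rintro ⟨x₀, q₀⟩
  obtain ⟨r, hr0, hr⟩ := hH.exists_le_on_ball (‖x₀‖ + 1) (‖q₀‖ + 1)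
  have hcont := hH.continuous
  have hc : Continuous fun z : Euc N × Euc N =>
      sSup ((fun p : Euc N => ⟪p, z.2⟫ - H (z.1, p)) '' Metric.closedBall 0 r) := by
    refine (isCompact_closedBall (0 : Euc N) r).continuous_sSup
      (f := fun (z : Euc N × Euc N) (p : Euc N) => ⟪p, z.2⟫ - H (z.1, p)) ?_
    simp only [Function.HasUncurry.uncurry, id]
    fun_prop
  refine hc.continuousAt.congr ?_
  have h1 : ∀ᶠ z : Euc N × Euc N in 𝓝 (x₀, q₀), ‖z.1‖ < ‖x₀‖ + 1 :=
    (show Continuous fun z : Euc N × Euc N => ‖z.1‖ by fun_prop).continuousAt.eventually_lt_const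
      (by simp)
  have h2 : ∀ᶠ z : Euc N × Euc N in 𝓝 (x₀, q₀), ‖z.2‖ < ‖q₀‖ + 1 :=
    (show Continuous fun z : Euc N × Euc N => ‖z.2‖ by fun_prop).continuousAt.eventually_lt_const
      (by simp)
  filter_upwards [h1, h2] with z hz1 hz2
  have hbdd := hH.bddAbove_range z.1 z.2
  have hbdd' : BddAbove ((fun p : Euc N => ⟪p, z.2⟫ - H (z.1, p)) '' Metric.closedBall 0 r) :=
    hbdd.mono (image_subset_range _ _)
  refine le_antisymm ?_ ?_
  · exact csSup_le_csSup hbdd ((Metric.nonempty_closedBall.2 hr0).image _) (image_subset_range _ _)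
  · refine csSup_le (range_nonempty _) ?_
    rintro _ ⟨p, rfl⟩
    obtain ⟨p', hp', hle⟩ := hr z.1 z.2 hz1.le hz2.le p
    exact hle.trans (le_csSup hbdd' ⟨p', by simpa using hp', rfl⟩)

/-- Subgradients over a bounded set are bounded and realize equality in Fenchel–Young. -/
theorem exists_dual_ball (hH : IsTonelli H) (R P : ℝ) :
    ∃ K : ℝ, ∀ x p : Euc N, ‖x‖ ≤ R → ‖p‖ ≤ P →
      ∃ q : Euc N, ‖q‖ ≤ K ∧ Lag H (x, q) = ⟪p, q⟫ - H (x, p) := by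
  obtain ⟨M, hM⟩ := hH.exists_bound R (P + 1)
  refine ⟨2 * M, fun x p hx hp => ?_⟩
  have hcont := hH.continuous
  obtain ⟨q, hq⟩ := (hH.convex x).exists_subgradient (by fun_prop) p
  have hM0 : 0 ≤ M := (abs_nonneg _).trans (hM x p hx (by linarith))
  refine ⟨q, ?_, le_antisymm (lag_le x q fun p' => ?_) ?_⟩
  · rcases eq_or_ne q 0 with rfl | hq0
    · simpa using hM0
    have hqn : 0 < ‖q‖ := norm_pos_iff.2 hq0
    have h1 := hq (p + ‖q‖⁻¹ • q)
    rw [add_sub_cancel_left, inner_smul_left, real_inner_self_eq_norm_sq] at h1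
    have h2 : ‖q‖⁻¹ * ‖q‖ ^ 2 = ‖q‖ := by field_simp
    have h3 : ‖p + ‖q‖⁻¹ • q‖ ≤ P + 1 := by
      refine (norm_add_le _ _).trans ?_
      have : ‖‖q‖⁻¹ • q‖ = 1 := by simp [norm_smul, hqn.ne']
      linarith
    have h4 := (abs_le.1 (hM x p hx (by linarith))).1
    have h5 := (abs_le.1 (hM x _ hx h3)).2
    simp only [conj_trivial, h2] at h1
    linarith
  · have := hq p'
    rw [inner_sub_left] at this
    linarith
  · linarith [hH.inner_le x p q]

/-- Testing against `q` in a suitable ball is enough to detect `H (x, p) ≤ a`. -/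
theorem exists_dual_test (hH : IsTonelli H) (R A : ℝ) :
    ∃ K : ℝ, ∀ x p : Euc N, ‖x‖ ≤ R → ∀ a ≤ A,
      (∀ q : Euc N, ‖q‖ ≤ K → ⟪p, q⟫ ≤ Lag H (x, q) + a) → H (x, p) ≤ a := by
  obtain ⟨M, hM⟩ := hH.exists_bound R 0
  obtain ⟨r, hr⟩ := hH.exists_superlinear R 1
  set P : ℝ := max (max r (max M A + 1)) 1 with hP
  have hPpos : 0 < P := lt_max_of_lt_right one_pos
  obtain ⟨K, hK⟩ := hH.exists_dual_ball R P
  refine ⟨K, fun x p hx a ha h => ?_⟩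
  rcases le_or_gt ‖p‖ P with hp | hp
  · obtain ⟨q, hq, hL⟩ := hK x p hx hp
    have := h q hq
    linarith
  · exfalso
    have hppos : 0 < ‖p‖ := hPpos.trans hp
    set τ : ℝ := P / ‖p‖ with hτ
    have hτ0 : 0 < τ := by positivity
    have hτ1 : τ < 1 := (div_lt_one hppos).2 hp
    have hnorm : ‖τ • p‖ = P := by
      rw [norm_smul, Real.norm_of_nonneg hτ0.le, hτ]
      field_simp
    obtain ⟨q, hq, hL⟩ := hK x (τ • p) hx hnorm.le
    have h1 := h q hq
    have h2 := hH.inner_le x 0 q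
    have h3 := (abs_le.1 (hM x 0 hx (by simp))).2
    have h4 := hr x hx (τ • p) (by
      rw [hnorm]; exact (le_max_left _ _).trans (le_max_left _ _))
    have h5 : max M A + 1 ≤ P := (le_max_right _ _).trans (le_max_left _ _)
    rw [hnorm] at h4
    rw [inner_smul_left] at hL
    simp only [inner_zero_left, conj_trivial] at h2 hL
    have h6 : τ * ⟪p, q⟫ ≤ τ * (Lag H (x, q) + a) := mul_le_mul_of_nonneg_left h1 hτ0.le
    have h7 : (1 - τ) * (-M) ≤ (1 - τ) * Lag H (x, q) :=
      mul_le_mul_of_nonneg_left (by linarith) (by linarith)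
    have h8 : τ * a ≤ τ * max M A :=
      mul_le_mul_of_nonneg_left (ha.trans (le_max_right _ _)) hτ0.le
    have h9 : (1 - τ) * M ≤ (1 - τ) * max M A :=
      mul_le_mul_of_nonneg_left (le_max_left _ _) (by linarith)
    nlinarith

theorem le_of_forall_inner_le (hH : IsTonelli H) {x p : Euc N} {a : ℝ}
    (h : ∀ q : Euc N, ⟪p, q⟫ ≤ Lag H (x, q) + a) : H (x, p) ≤ a := by
  obtain ⟨K, hK⟩ := hH.exists_dual_test ‖x‖ a
  exact hK x p le_rfl a le_rfl fun q _ => h q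

end IsTonelli

/-- Integral-free formulation, through increments along segments, of the inequality
`Du(x)·q ≤ G (x, q)`. -/
def SegSub {N : ℕ} (G : Euc N × Euc N → ℝ) (u : Euc N → ℝ) : Prop :=
  ∀ (x q : Euc N) (t C : ℝ), 0 ≤ t → (∀ s ∈ Icc 0 t, G (x + s • q, q) ≤ C) →
    u (x + t • q) ≤ u x + t * C

section SegSub

variable {N : ℕ} {H : Euc N × Euc N → ℝ} {G : Euc N × Euc N → ℝ} {u : Euc N → ℝ}

theorem segSub_of_ae (hu : LocallyLipschitz u) (hG : Continuous G)
    (h : ∀ᵐ x : Euc N, DifferentiableAt ℝ u x → ∀ q, fderiv ℝ u x q ≤ G (x, q)) :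
    SegSub G u := by
  intro x q t C ht hC
  have hη : ∀ η > (0 : ℝ), u (x + t • q) ≤ u x + t * (C + η) := by
    intro η hη
    refine hu.segment_le (U := {y | G (y, q) < C + η})
      (isOpen_lt (by fun_prop) continuous_const) ht (fun s hs => ?_) ?_
    · exact (hC s hs).trans_lt (by linarith)
    · filter_upwards [h] with y hy hyU hyd
      exact (hy hyd q).trans (le_of_lt hyU)
  have hlim : Tendsto (fun η : ℝ => u x + t * (C + η)) (𝓝[>] 0) (𝓝 (u x + t * (C + 0))) :=
    (Continuous.tendsto (by fun_prop) 0).mono_left nhdsWithin_le_nhds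
  have := ge_of_tendsto hlim (by
    filter_upwards [self_mem_nhdsWithin] with η h' using hη η h')
  simpa using this

theorem SegSub.fderiv_le (h : SegSub G u) (hG : Continuous G) {x : Euc N}
    (hd : DifferentiableAt ℝ u x) (q : Euc N) : fderiv ℝ u x q ≤ G (x, q) := by
  refine le_of_forall_pos_le_add fun η hη => ?_
  have hline : HasDerivAt (fun s : ℝ => x + s • q) q 0 := by
    simpa using ((hasDerivAt_id (0 : ℝ)).smul_const q).const_add x
  have hd' : HasFDerivAt u (fderiv ℝ u x) (x + (0 : ℝ) • q) := by simpa using hd.hasFDerivAt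
  have hder := (hd'.comp_hasDerivAt (0 : ℝ) hline).tendsto_slope_zero_right
  have hnear : ∀ᶠ s in 𝓝 (0 : ℝ), G (x + s • q, q) < G (x, q) + η := by
    refine (show Continuous fun s : ℝ => G (x + s • q, q) by fun_prop
      ).continuousAt.eventually_lt_const ?_
    simpa using hη
  obtain ⟨ρ, hρ, hball⟩ := Metric.eventually_nhds_iff.1 hnear
  refine le_of_tendsto hder ?_
  filter_upwards [Ioo_mem_nhdsGT hρ] with t ht
  have := h x q t (G (x, q) + η) ht.1.le (fun s hs => (hball (by
    rw [Real.dist_eq, sub_zero, abs_of_nonneg hs.1]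
    exact hs.2.trans_lt ht.2)).le)
  simp only [Function.comp, zero_add, zero_smul, add_zero, smul_eq_mul]
  rw [inv_mul_le_iff₀ ht.1]
  linarith

/-- Increment bounds along all segments of a ball give a Lipschitz bound on that ball. -/
theorem abs_sub_le_of_segment {R C : ℝ}
    (h : ∀ (x q : Euc N) (t : ℝ), 0 ≤ t → ‖q‖ ≤ 1 → (∀ s ∈ Icc 0 t, ‖x + s • q‖ ≤ R) →
      u (x + t • q) ≤ u x + t * C) {x y : Euc N} (hx : ‖x‖ ≤ R) (hy : ‖y‖ ≤ R) :
    |u x - u y| ≤ C * ‖x - y‖ := by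
  have key : ∀ x y : Euc N, ‖x‖ ≤ R → ‖y‖ ≤ R → u y ≤ u x + C * ‖x - y‖ := by
    intro x y hx hy
    rcases eq_or_ne x y with rfl | hxy
    · simp
    have hpos : 0 < ‖y - x‖ := norm_pos_iff.2 (sub_ne_zero.2 hxy.symm)
    have := h x (‖y - x‖⁻¹ • (y - x)) ‖y - x‖ hpos.le (by simp [norm_smul, hpos.ne']) ?_
    · rw [smul_smul, mul_inv_cancel₀ hpos.ne', one_smul, add_sub_cancel, norm_sub_rev] at this
      linarith
    · intro s hs
      have hmem : x + (s * ‖y - x‖⁻¹) • (y - x) ∈ Metric.closedBall (0 : Euc N) R := by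
        refine (convex_closedBall (0 : Euc N) R).add_smul_sub_mem (by simpa using hx)
          (by simpa using hy) ⟨by have := hs.1; positivity, ?_⟩
        rw [← div_eq_mul_inv]
        exact (div_le_one hpos).2 hs.2
      rw [smul_smul]
      simpa using hmem
  have h1 := key x y hx hy
  have h2 := key y x hy hx
  rw [norm_sub_rev] at h2
  rw [abs_le]
  constructor <;> linarith

theorem IsTonelli.exists_lag_bound (hH : IsTonelli H) (R Q : ℝ) :
    ∃ C : ℝ, 0 ≤ C ∧ ∀ x q : Euc N, ‖x‖ ≤ R → ‖q‖ ≤ Q → Lag H (x, q) ≤ C := by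
  obtain ⟨M, hM⟩ := ((isCompact_closedBall (0 : Euc N) R).prod
    (isCompact_closedBall (0 : Euc N) Q)).exists_bound_of_continuousOn
      hH.continuous_lag.continuousOn
  exact ⟨max M 0, le_max_right _ _, fun x q hx hq =>
    ((le_abs_self _).trans (hM (x, q) (by simp [hx, hq]))).trans (le_max_left _ _)⟩

/-- Subsolutions are Lipschitz on balls, with a constant depending only on the ball and on an
upper bound for the level. -/
theorem IsTonelli.exists_lipschitz (hH : IsTonelli H) (R A : ℝ) :
    ∃ C : ℝ, 0 ≤ C ∧ ∀ (u : Euc N → ℝ) (a : ℝ), a ≤ A → SegSub (fun z => Lag H z + a) u →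
      ∀ x y : Euc N, ‖x‖ ≤ R → ‖y‖ ≤ R → |u x - u y| ≤ C * ‖x - y‖ := by
  obtain ⟨C, hC0, hC⟩ := hH.exists_lag_bound R 1
  refine ⟨C + max A 0, by positivity, fun u a ha hu x y hx hy => ?_⟩
  refine abs_sub_le_of_segment (R := R) (fun x q t ht hq hseg => ?_) hx hy
  refine hu x q t _ ht fun s hs => ?_
  exact add_le_add (hC _ _ (hseg s hs) hq) (ha.trans (le_max_left _ _))

theorem SegSub.locallyLipschitz (hH : IsTonelli H) {a : ℝ}
    (hu : SegSub (fun z => Lag H z + a) u) : LocallyLipschitz u := by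
  intro x
  obtain ⟨C, hC0, hC⟩ := hH.exists_lipschitz (‖x‖ + 1) a
  refine ⟨⟨C, hC0⟩, Metric.ball x 1, Metric.ball_mem_nhds x one_pos, ?_⟩
  have hball : ∀ y ∈ Metric.ball x 1, ‖y‖ ≤ ‖x‖ + 1 := by
    intro y hy
    have h1 : ‖y - x‖ < 1 := by simpa [dist_eq_norm] using hy
    have := norm_le_norm_add_norm_sub' y x
    linarith
  refine LipschitzOnWith.of_dist_le_mul fun y hy z hz => ?_
  rw [Real.dist_eq, dist_eq_norm]
  exact hC u a le_rfl hu y z (hball y hy) (hball z hz)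

theorem SegSub.isSubsol (hH : IsTonelli H) {a : ℝ}
    (hu : SegSub (fun z => Lag H z + a) u) : IsSubsol H a u := by
  have hL := hH.continuous_lag
  refine ⟨hu.locallyLipschitz hH, Eventually.of_forall fun x hd => ?_⟩
  refine hH.le_of_forall_inner_le fun q => ?_
  rw [inner_gradient]
  exact hu.fderiv_le (by fun_prop) hd q

theorem IsSubsol.segSub (hH : IsTonelli H) {a : ℝ} (hu : IsSubsol H a u) :
    SegSub (fun z => Lag H z + a) u := by
  have hL := hH.continuous_lag
  refine segSub_of_ae hu.1 (by fun_prop) ?_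
  filter_upwards [hu.2] with x hx hd q
  rw [← inner_gradient]
  linarith [hH.inner_le x (gradient u x) q, hx hd]

theorem IsDiscSubsol.segSub (hH : IsTonelli H) {lam M : ℝ} (hlam : 0 ≤ lam)
    (hu : IsDiscSubsol H lam u) (hM : ∀ x, -M ≤ u x) :
    SegSub (fun z => Lag H z + lam * M) u := by
  have hL := hH.continuous_lag
  refine segSub_of_ae hu.1 (by fun_prop) ?_
  filter_upwards [hu.2] with x hx hd q
  rw [← inner_gradient]
  have := mul_le_mul_of_nonneg_left (hM x) hlam
  linarith [hH.inner_le x (gradient u x) q, hx hd]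

/-- Compactness of families of almost critical subsolutions. -/
theorem exists_limit_segSub {𝒰 : Ultrafilter ℝ} (h𝒰 : (𝒰 : Filter ℝ) ≤ 𝓝 0)
    {v : ℝ → Euc N → ℝ} {M : ℝ}
    (hv : ∀ᶠ lam in (𝒰 : Filter ℝ), SegSub (fun z => G z + lam * M) (v lam))
    (hb : ∀ x, ∃ B, ∀ᶠ lam in (𝒰 : Filter ℝ), |v lam x| ≤ B) :
    ∃ V : Euc N → ℝ, (∀ x, Tendsto (fun lam => v lam x) 𝒰 (𝓝 (V x))) ∧ SegSub G V := by
  have hlim : ∀ x, ∃ y, Tendsto (fun lam => v lam x) 𝒰 (𝓝 y) := by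
    intro x
    obtain ⟨B, hB⟩ := hb x
    obtain ⟨y, -, hy⟩ := (isCompact_Icc (a := -B) (b := B)).ultrafilter_le_nhds
      (𝒰.map fun lam => v lam x) (by
        rw [le_principal_iff, Ultrafilter.coe_map, mem_map]
        exact hB.mono fun lam h => abs_le.1 h)
    exact ⟨y, hy⟩
  choose V hV using hlim
  refine ⟨V, hV, fun x q t C ht hC => ?_⟩
  have hid : Tendsto (fun lam : ℝ => lam) 𝒰 (𝓝 0) := h𝒰
  have hR : Tendsto (fun lam : ℝ => v lam x + t * (C + lam * M)) 𝒰 (𝓝 (V x + t * (C + 0 * M))) :=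
    (hV x).add (((hid.mul_const M).const_add C).const_mul t)
  have := le_of_tendsto_of_tendsto (hV (x + t • q)) hR (by
    filter_upwards [hv] with lam hlam
    exact hlam x q t _ ht fun s hs => by linarith [hC s hs])
  simpa using this

end SegSub

/-- A Tonelli Hamiltonian with critical value `0` for which all `ε`-Lipschitz functions are strict
subsolutions, at level `m < 0`, outside the ball of radius `R`. -/
structure IsCritical {N : ℕ} (H : Euc N × Euc N → ℝ) (ε R m : ℝ) : Prop where
  tonelli : IsTonelli H
  eps_pos : 0 < ε
  radius_nonneg : 0 ≤ R
  level_neg : m < 0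
  outer : ∀ x p : Euc N, R ≤ ‖x‖ → ‖p‖ ≤ ε → H (x, p) ≤ m
  level_nonneg : ∀ (a : ℝ) (u : Euc N → ℝ), IsSubsol H a u → 0 ≤ a
  exists_subsol : ∀ a : ℝ, 0 < a → ∃ u : Euc N → ℝ, IsSubsol H a u

section Critical

variable {N : ℕ} {H : Euc N × Euc N → ℝ} {ε R m : ℝ}

theorem gradient_zero_of_eventually_eq_const {u : Euc N → ℝ} {x : Euc N} {b : ℝ}
    (h : ∀ᶠ y in 𝓝 x, u y = b) : gradient u x = 0 := by
  have : fderiv ℝ u x = 0 := by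
    rw [EventuallyEq.fderiv_eq (f₁ := u) (f := fun _ => b) h]
    simp
  simp [gradient, this]

theorem gradient_congr {u v : Euc N → ℝ} {x : Euc N} (h : ∀ᶠ y in 𝓝 x, u y = v y) :
    gradient u x = gradient v x := by
  simp only [gradient, EventuallyEq.fderiv_eq h]

theorem IsCritical.exists_clamp (hc : IsCritical H ε R m) {u : Euc N → ℝ}
    (hu : LocallyLipschitz u) {R₀ a b : ℝ} (hR : R ≤ R₀)
    (hab : ∀ x, ‖x‖ ≤ R₀ → a ≤ u x ∧ u x ≤ b) {g : Euc N → ℝ} (hg : ∀ x, m ≤ g x)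
    (hae : ∀ᵐ x : Euc N, ‖x‖ ≤ R₀ + (b - a) / ε → DifferentiableAt ℝ u x →
      H (x, gradient u x) ≤ g x) :
    ∃ U : Euc N → ℝ, LocallyLipschitz U ∧ (∀ x, ‖x‖ ≤ R₀ → U x = u x) ∧
      (∀ x, a ≤ U x ∧ U x ≤ b) ∧
      (∀ᵐ x : Euc N, DifferentiableAt ℝ U x → H (x, gradient U x) ≤ g x) ∧
      (∀ᵐ x : Euc N, R₀ + (b - a) / ε < ‖x‖ → DifferentiableAt ℝ U x →
        H (x, gradient U x) ≤ m) := by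
  have hε := hc.eps_pos
  have hle : a ≤ b := by
    obtain ⟨h1, h2⟩ := hab 0 (by simpa using hc.radius_nonneg.trans hR)
    exact h1.trans h2
  have hR₁ : R₀ ≤ R₀ + (b - a) / ε := by
    have : 0 ≤ (b - a) / ε := div_nonneg (by linarith) hε.le
    linarith
  set f₁ : Euc N → ℝ := fun x => max (u x) a with hf₁
  set f₂ : Euc N → ℝ := fun x => min (f₁ x) b with hf₂
  set φ : Euc N → ℝ := fun x => a + ε * (‖x‖ - R₀) with hφ
  set f₃ : Euc N → ℝ := fun x => min (φ x) b with hf₃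
  set U : Euc N → ℝ := fun x => max (f₂ x) (f₃ x) with hU
  have hφlip : LipschitzWith ⟨ε, hε.le⟩ φ := by
    refine LipschitzWith.of_dist_le_mul fun x y => ?_
    rw [Real.dist_eq, dist_eq_norm]
    have h1 : φ x - φ y = ε * (‖x‖ - ‖y‖) := by simp only [hφ]; ring
    rw [h1, abs_mul, abs_of_pos hε]
    exact mul_le_mul_of_nonneg_left (abs_norm_sub_norm_le x y) hε.le
  have l₁ : LocallyLipschitz f₁ := hu.max_const a
  have l₂ : LocallyLipschitz f₂ := l₁.min_const b
  have l₃ : LocallyLipschitz f₃ := hφlip.locallyLipschitz.min_const b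
  have lU : LocallyLipschitz U := l₂.max l₃
  have hin : ∀ x, ‖x‖ ≤ R₀ → U x = u x := by
    intro x hx
    obtain ⟨h1, h2⟩ := hab x hx
    have h3 : φ x ≤ a := by
      have : ε * (‖x‖ - R₀) ≤ 0 := mul_nonpos_of_nonneg_of_nonpos hε.le (by linarith)
      simp only [hφ]; linarith
    simp only [hU, hf₂, hf₃, hf₁, max_eq_left h1, min_eq_left h2]
    exact max_eq_left (((min_le_left _ _).trans h3).trans h1)
  have hout : ∀ x, R₀ + (b - a) / ε < ‖x‖ → U x = b := by
    intro x hx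
    have h3 : b ≤ φ x := by
      have h4 : (b - a) / ε ≤ ‖x‖ - R₀ := by linarith
      rw [div_le_iff₀ hε] at h4
      simp only [hφ]; linarith
    simp only [hU, hf₂, hf₃, min_eq_right h3]
    exact max_eq_right (min_le_right _ _)
  have hgout : ∀ x, R₀ + (b - a) / ε < ‖x‖ → H (x, gradient U x) ≤ m := by
    intro x hx
    have : gradient U x = 0 := by
      refine gradient_zero_of_eventually_eq_const (b := b) ?_
      filter_upwards [(isOpen_lt continuous_const continuous_norm).mem_nhds hx] with y hy
        using hout y hy
    rw [this]
    exact hc.outer x 0 (by linarith) (by simpa using hε.le)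
  refine ⟨U, lU, hin, fun x => ⟨?_, ?_⟩, ?_, Eventually.of_forall fun x hx _ => hgout x hx⟩
  · exact (le_min (le_max_right _ _) hle).trans (le_max_left _ _)
  · exact max_le (min_le_right _ _) (min_le_right _ _)
  · filter_upwards [hae, hu.ae_differentiableAt_euc, l₁.ae_differentiableAt_euc,
      l₂.ae_differentiableAt_euc, l₃.ae_differentiableAt_euc,
      hφlip.locallyLipschitz.ae_differentiableAt_euc] with x hx du d₁ d₂ d₃ dφ dU
    rcases lt_or_ge (R₀ + (b - a) / ε) ‖x‖ with h1 | h1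
    · exact (hgout x h1).trans (hg x)
    rcases lt_or_ge ‖x‖ R₀ with h2 | h2
    · have : gradient U x = gradient u x := by
        refine gradient_congr ?_
        filter_upwards [(isOpen_lt continuous_norm continuous_const).mem_nhds h2] with y hy
          using hin y (le_of_lt hy)
      rw [this]
      exact hx h1 du
    have hsmall : ∀ p : Euc N, ‖p‖ ≤ ε → H (x, p) ≤ g x :=
      fun p hp => (hc.outer x p (hR.trans h2) hp).trans (hg x)
    have hzero : ∀ c : ℝ, H (x, gradient (fun _ : Euc N => c) x) ≤ g x := by
      intro c
      refine hsmall _ ?_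
      rw [gradient_zero_of_eventually_eq_const (b := c) (Eventually.of_forall fun _ => rfl)]
      simpa using hε.le
    have dc : ∀ c : ℝ, DifferentiableAt ℝ (fun _ : Euc N => c) x := fun c => by fun_prop
    rcases gradient_max d₂ d₃ dU with ⟨-, h⟩ | ⟨-, h⟩ <;> rw [h]
    · rcases gradient_min d₁ (dc b) d₂ with ⟨-, h⟩ | ⟨-, h⟩ <;> rw [h]
      · rcases gradient_max du (dc a) d₁ with ⟨-, h⟩ | ⟨-, h⟩ <;> rw [h]
        · exact hx h1 du
        · exact hzero a
      · exact hzero b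
    · rcases gradient_min dφ (dc b) d₃ with ⟨-, h⟩ | ⟨-, h⟩ <;> rw [h]
      · refine hsmall _ ?_
        simp only [gradient, LinearIsometryEquiv.norm_map]
        exact norm_fderiv_le_of_lipschitz ℝ hφlip
      · exact hzero b

theorem SegSub.sub_const {G : Euc N × Euc N → ℝ} {u : Euc N → ℝ} (h : SegSub G u) (c : ℝ) :
    SegSub G fun x => u x - c :=
  fun x q t C ht hC => by linarith [h x q t C ht hC]

theorem IsSubsol.sub_const {a : ℝ} {u : Euc N → ℝ} (hH : IsTonelli H) (h : IsSubsol H a u)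
    (c : ℝ) : IsSubsol H a fun x => u x - c :=
  ((h.segSub hH).sub_const c).isSubsol hH

theorem IsCritical.exists_critical_subsol (hc : IsCritical H ε R m) :
    ∃ u : Euc N → ℝ, IsSubsol H 0 u := by
  have hH := hc.tonelli
  have h : ∀ a : ℝ, ∃ u : Euc N → ℝ, 0 < a → IsSubsol H a u ∧ u 0 = 0 := by
    intro a
    by_cases ha : 0 < a
    · obtain ⟨u, hu⟩ := hc.exists_subsol a ha
      exact ⟨fun x => u x - u 0, fun _ => ⟨hu.sub_const hH _, sub_self _⟩⟩
    · exact ⟨0, fun h => absurd h ha⟩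
  choose v hv using h
  set 𝒰 : Ultrafilter ℝ := Ultrafilter.of (𝓝[>] (0 : ℝ)) with h𝒰
  have hle : (𝒰 : Filter ℝ) ≤ 𝓝[>] 0 := Ultrafilter.of_le _
  have hpos : ∀ᶠ lam : ℝ in (𝒰 : Filter ℝ), lam ∈ Ioo (0 : ℝ) 1 :=
    hle (Ioo_mem_nhdsGT one_pos)
  obtain ⟨V, -, hV⟩ := exists_limit_segSub (G := Lag H) (hle.trans nhdsWithin_le_nhds)
    (v := v) (M := 1) (by
      filter_upwards [hpos] with lam h
      simpa using (hv lam h.1).1.segSub hH) (by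
      intro x
      obtain ⟨C, -, hC⟩ := hH.exists_lipschitz ‖x‖ 1
      refine ⟨C * ‖x - 0‖, ?_⟩
      filter_upwards [hpos] with lam h
      have := hC (v lam) lam h.2.le ((hv lam h.1).1.segSub hH) x 0 le_rfl (by simp)
      rwa [(hv lam h.1).2, sub_zero] at this)
  exact ⟨V, SegSub.isSubsol hH (by simpa using hV)⟩

/-- A bounded critical subsolution which is strict outside a ball. -/
theorem IsCritical.exists_bounded_critical_subsol (hc : IsCritical H ε R m) :
    ∃ (v : Euc N → ℝ) (M R₁ : ℝ), IsSubsol H 0 v ∧ (∀ x, |v x| ≤ M) ∧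
      ∀ᵐ x : Euc N, R₁ < ‖x‖ → DifferentiableAt ℝ v x → H (x, gradient v x) ≤ m := by
  obtain ⟨u, hu⟩ := hc.exists_critical_subsol
  obtain ⟨M, hM⟩ := (isCompact_closedBall (0 : Euc N) R).exists_bound_of_continuousOn
    hu.1.continuous.continuousOn
  obtain ⟨U, hUl, -, hUb, hU, hUo⟩ := hc.exists_clamp hu.1 le_rfl (a := -M) (b := M)
    (fun x hx => abs_le.1 (hM x (by simpa using hx))) (g := fun _ => 0)
    (fun _ => hc.level_neg.le) (by filter_upwards [hu.2] with x hx _ using hx)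
  exact ⟨U, M, _, ⟨hUl, hU⟩, fun x => abs_le.2 (hUb x), hUo⟩

theorem IsDiscSubsol.max {lam : ℝ} {u v : Euc N → ℝ} (hu : IsDiscSubsol H lam u)
    (hv : IsDiscSubsol H lam v) : IsDiscSubsol H lam fun x => max (u x) (v x) := by
  refine ⟨hu.1.max hv.1, ?_⟩
  filter_upwards [hu.2, hv.2, hu.1.ae_differentiableAt_euc, hv.1.ae_differentiableAt_euc]
    with x h1 h2 du dv dm
  rcases gradient_max du dv dm with ⟨h, hg⟩ | ⟨h, hg⟩
  · rw [hg, max_eq_left h]; exact h1 du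
  · rw [hg, max_eq_right h]; exact h2 dv

theorem IsSubsol.isDiscSubsol {lam : ℝ} (hlam : 0 ≤ lam) {u : Euc N → ℝ} (hu : IsSubsol H 0 u)
    (hneg : ∀ x, u x ≤ 0) : IsDiscSubsol H lam u := by
  refine ⟨hu.1, ?_⟩
  filter_upwards [hu.2] with x hx hd
  have := mul_nonpos_of_nonneg_of_nonpos hlam (hneg x)
  linarith [hx hd]

/-- A discounted subsolution cannot be bounded below by a positive constant on the ball of
radius `R`. -/
theorem IsCritical.exists_lt_of_isDiscSubsol (hc : IsCritical H ε R m) {lam η : ℝ}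
    (hlam : 0 < lam) (hη : 0 < η) {v : Euc N → ℝ} (hv : IsDiscSubsol H lam v) :
    ∃ x, ‖x‖ ≤ R ∧ v x < η := by
  by_contra! hcon
  have hsub : IsSubsol H (max (-(lam * η)) m) fun x => max (v x) η := by
    refine ⟨hv.1.max_const η, ?_⟩
    filter_upwards [hv.2, hv.1.ae_differentiableAt_euc] with x hx dv dm
    have key : η ≤ v x → H (x, gradient v x) ≤ max (-(lam * η)) m := by
      intro h
      have h1 := hx dv
      have h2 := mul_le_mul_of_nonneg_left h hlam.le
      exact le_max_of_le_left (by linarith)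
    rcases gradient_max dv (by fun_prop) dm with ⟨h, hg⟩ | ⟨h, hg⟩
    · rw [hg]; exact key h
    · rcases lt_or_ge ‖x‖ R with hR | hR
      · have : gradient (fun x => max (v x) η) x = gradient v x := by
          refine gradient_congr ?_
          filter_upwards [(isOpen_lt continuous_norm continuous_const).mem_nhds hR] with y hy
            using max_eq_left (hcon y (le_of_lt hy))
        rw [this]
        exact key (hcon x hR.le)
      · rw [hg, gradient_zero_of_eventually_eq_const (b := η) (Eventually.of_forall fun _ => rfl)]
        exact le_max_of_le_right (hc.outer x 0 hR (by simpa using hc.eps_pos.le))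
  have h0 := hc.level_nonneg _ _ hsub
  have h1 : max (-(lam * η)) m < 0 := max_lt (by have := mul_pos hlam hη; linarith) hc.level_neg
  linarith

/-- Every discounted subsolution is below one which is bounded from below uniformly in the
discount factor. -/
theorem IsCritical.exists_raise (hc : IsCritical H ε R m) :
    ∃ M : ℝ, 0 ≤ M ∧ ∀ lam : ℝ, 0 < lam → ∀ v : Euc N → ℝ, IsDiscSubsol H lam v →
      ∃ V : Euc N → ℝ, IsDiscSubsol H lam V ∧ (∀ x, v x ≤ V x) ∧ ∀ x, -M ≤ V x := by
  obtain ⟨v₀, M, -, hv₀, hM, -⟩ := hc.exists_bounded_critical_subsol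
  have hM0 : 0 ≤ M := (abs_nonneg _).trans (hM 0)
  refine ⟨2 * M, by linarith, fun lam hlam v hv => ⟨fun x => max (v x) (v₀ x - M), ?_, ?_, ?_⟩⟩
  · exact hv.max ((hv₀.sub_const hc.tonelli M).isDiscSubsol hlam.le fun x => by
      linarith [(abs_le.1 (hM x)).2])
  · exact fun x => le_max_left _ _
  · exact fun x => le_max_of_le_right (by linarith [(abs_le.1 (hM x)).1])

theorem IsCritical.exists_disc_bound (hc : IsCritical H ε R m) (r : ℝ) :
    ∃ C : ℝ, ∀ lam : ℝ, 0 < lam → lam ≤ 1 → ∀ v : Euc N → ℝ, IsDiscSubsol H lam v →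
      ∀ x, ‖x‖ ≤ r → v x ≤ C := by
  obtain ⟨M, hM0, hM⟩ := hc.exists_raise
  obtain ⟨C, hC0, hC⟩ := hc.tonelli.exists_lipschitz (max r R) M
  refine ⟨1 + C * (2 * max r R), fun lam hl hl1 v hv x hx => ?_⟩
  obtain ⟨V, hV, hle, hVM⟩ := hM lam hl v hv
  obtain ⟨y, hy, hy1⟩ := hc.exists_lt_of_isDiscSubsol hl one_pos hV
  have hx' : ‖x‖ ≤ max r R := hx.trans (le_max_left _ _)
  have hy' : ‖y‖ ≤ max r R := hy.trans (le_max_right _ _)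
  have h1 := hC V (lam * M) (mul_le_of_le_one_left hM0 hl1) (hV.segSub hc.tonelli hl.le hVM) x y
    hx' hy'
  have h2 : C * ‖x - y‖ ≤ C * (2 * max r R) :=
    mul_le_mul_of_nonneg_left ((norm_sub_le x y).trans (by linarith)) hC0
  linarith [(abs_le.1 h1).2, hle x]

theorem IsCritical.exists_lag_lower_bound (hc : IsCritical H ε R m) :
    ∃ M : ℝ, ∀ z, -M ≤ Lag H z := by
  obtain ⟨M, hM⟩ := hc.tonelli.exists_bound R 0
  refine ⟨max M 0, fun z => ?_⟩
  have h1 := hc.tonelli.inner_le z.1 0 z.2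
  have h2 : H (z.1, 0) ≤ max M 0 := by
    rcases le_total ‖z.1‖ R with h | h
    · exact ((le_abs_self _).trans (hM z.1 0 h (by simp))).trans (le_max_left _ _)
    · exact ((hc.outer z.1 0 h (by simpa using hc.eps_pos.le)).trans hc.level_neg.le).trans
        (le_max_right _ _)
  simp only [inner_zero_left] at h1
  linarith

theorem IsCritical.exists_mather_radius (hc : IsCritical H ε R m) :
    ∃ R₁ : ℝ, ∀ μ : Measure (Euc N × Euc N), MatherMeasure H μ → ∀ᵐ z ∂μ, ‖z.1‖ ≤ R₁ := by
  obtain ⟨v₀, -, R₁, hv₀, -, hstrict⟩ := hc.exists_bounded_critical_subsol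
  obtain ⟨M, hM⟩ := hc.exists_lag_lower_bound
  have hL := hc.tonelli.continuous_lag
  have hm := hc.level_neg
  refine ⟨R₁, fun μ hμ => ?_⟩
  obtain ⟨hprob, hintg, hzero, htest⟩ := hμ
  set χ : Euc N × Euc N → ℝ := fun z => max 0 (min 1 (‖z.1‖ - R₁)) with hχ
  have hχc : Continuous χ := by fun_prop
  have hχ0 : ∀ z, 0 ≤ χ z := fun z => le_max_left _ _
  have hχ1 : ∀ z, χ z ≤ 1 := fun z => max_le zero_le_one (min_le_left _ _)
  have hχint : Integrable χ μ :=
    Integrable.of_bound hχc.aestronglyMeasurable 1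
      (Eventually.of_forall fun z => by rw [Real.norm_of_nonneg (hχ0 z)]; exact hχ1 z)
  have h := htest (fun z => Lag H z + m * χ z) (by fun_prop)
    ⟨-M + m, by
      rintro _ ⟨z, rfl⟩
      have := hM z
      have := hχ1 z
      simp only
      nlinarith⟩
    ⟨v₀, hv₀.1, by
      filter_upwards [hv₀.2, hstrict] with x h1 h2 hd q
      rw [← inner_gradient]
      have h3 := hc.tonelli.inner_le x (gradient v₀ x) q
      rcases lt_or_ge R₁ ‖x‖ with h | h
      · have := h2 h hd
        have := hχ1 (x, q)
        nlinarith
      · have : χ (x, q) = 0 := by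
          simp only [hχ]
          exact max_eq_left ((min_le_right _ _).trans (by linarith))
        rw [this]
        linarith [h1 hd]⟩ (hintg.add (hχint.const_mul m))
  rw [integral_add hintg (hχint.const_mul m), hzero, integral_const_mul, zero_add] at h
  have hle : ∫ z, χ z ∂μ ≤ 0 := by
    by_contra! hcon
    nlinarith
  have hz : ∫ z, χ z ∂μ = 0 := le_antisymm hle (integral_nonneg hχ0)
  filter_upwards [(integral_eq_zero_iff_of_nonneg hχ0 hχint).1 hz] with z hz
  by_contra! hcon
  have : 0 < χ z := lt_max_of_lt_right (lt_min one_pos (by linarith))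
  simp only [Pi.zero_apply] at hz
  linarith

/-- A continuous function of `x` is integrable against a measure concentrated on a ball. -/
theorem integrable_fst_of_ae_ball {μ : Measure (Euc N × Euc N)} [IsFiniteMeasure μ] {r : ℝ}
    (hμ : ∀ᵐ z ∂μ, ‖z.1‖ ≤ r) {v : Euc N → ℝ} (hv : Continuous v) :
    Integrable (fun z : Euc N × Euc N => v z.1) μ := by
  obtain ⟨M, hM⟩ := (isCompact_closedBall (0 : Euc N) r).exists_bound_of_continuousOn
    hv.continuousOn
  refine Integrable.of_bound (hv.comp continuous_fst).aestronglyMeasurable M ?_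
  filter_upwards [hμ] with z hz
  exact hM z.1 (by simpa using hz)

theorem IsCritical.integral_disc_nonpos (hc : IsCritical H ε R m) {lam : ℝ} (hlam : 0 < lam)
    {v : Euc N → ℝ} (hv : IsDiscSubsol H lam v) {μ : Measure (Euc N × Euc N)}
    (hμ : MatherMeasure H μ) : ∫ z, v z.1 ∂μ ≤ 0 := by
  obtain ⟨R₁, hR₁⟩ := hc.exists_mather_radius
  have hsupp := hR₁ μ hμ
  obtain ⟨hprob, hintg, hzero, htest⟩ := hμ
  obtain ⟨M, hM⟩ := hc.exists_lag_lower_bound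
  have hL := hc.tonelli.continuous_lag
  have hvc := hv.1.continuous
  obtain ⟨C, hC⟩ := (isCompact_closedBall (0 : Euc N) R₁).exists_bound_of_continuousOn
    hvc.continuousOn
  have hintg' : Integrable (fun z : Euc N × Euc N => min (v z.1) C) μ :=
    integrable_fst_of_ae_ball (v := fun x => min (v x) C) hsupp (by fun_prop)
  have h := htest (fun z => Lag H z - lam * min (v z.1) C) (by fun_prop)
    ⟨-M - lam * C, by
      rintro _ ⟨z, rfl⟩
      have := hM z
      have := mul_le_mul_of_nonneg_left (min_le_right (v z.1) C) hlam.le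
      simp only
      linarith⟩
    ⟨v, hv.1, by
      filter_upwards [hv.2] with x h1 hd q
      rw [← inner_gradient]
      have h3 := hc.tonelli.inner_le x (gradient v x) q
      have := mul_le_mul_of_nonneg_left (min_le_left (v x) C) hlam.le
      linarith [h1 hd]⟩ (hintg.sub (hintg'.const_mul lam))
  rw [integral_sub hintg (hintg'.const_mul lam), hzero, integral_const_mul] at h
  have heq : ∫ z, v z.1 ∂μ = ∫ z, min (v z.1) C ∂μ := by
    refine integral_congr_ae ?_
    filter_upwards [hsupp] with z hz
    exact (min_eq_left ((le_abs_self _).trans (hC z.1 (by simpa using hz)))).symm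
  rw [heq]
  by_contra! hcon
  nlinarith

end Critical

open scoped CompactlySupported in
/-- The Riesz representation of a normalized positive functional on a compact space. -/
theorem exists_probabilityMeasure_of_positive {X : Type*} [TopologicalSpace X] [CompactSpace X]
    [T2Space X] [MeasurableSpace X] [BorelSpace X] (F : C(X, ℝ) →ₗ[ℝ] ℝ) (h1 : F 1 = 1)
    (hpos : ∀ Φ : C(X, ℝ), (∀ z, 0 ≤ Φ z) → 0 ≤ F Φ) :
    ∃ μ : Measure X, IsProbabilityMeasure μ ∧ ∀ Φ : C(X, ℝ), ∫ z, Φ z ∂μ = F Φ := by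
  let J : C_c(X, ℝ) →ₗ[ℝ] C(X, ℝ) :=
    { toFun := fun φ => φ.toContinuousMap
      map_add' := fun _ _ => rfl
      map_smul' := fun _ _ => rfl }
  let Λ : C_c(X, ℝ) →ₚ[ℝ] ℝ := PositiveLinearMap.mk₀ (F.comp J) fun φ hφ => hpos _ fun z => hφ z
  have hintg : ∀ Φ : C(X, ℝ), ∫ z, Φ z ∂(RealRMK.rieszMeasure Λ) = F Φ := by
    intro Φ
    exact RealRMK.integral_rieszMeasure Λ
      (CompactlySupportedContinuousMap.continuousMapEquiv Φ)
  refine ⟨RealRMK.rieszMeasure Λ, ⟨?_⟩, hintg⟩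
  have h := hintg 1
  simp only [ContinuousMap.one_apply, h1, integral_const, smul_eq_mul, mul_one] at h
  rw [measureReal_def, ENNReal.toReal_eq_one_iff] at h
  exact h

section Duality

variable {N : ℕ} {H : Euc N × Euc N → ℝ} {ε R m : ℝ}

/-- If the functions `t L + β - v` admit no subsolution for large `t`, then some Mather measure
gives `v` an average of at least `β`. -/
theorem IsCritical.exists_matherMeasure (hc : IsCritical H ε R m) {v : Euc N → ℝ}
    (hv : Continuous v) (r K β T : ℝ)
    (hno : ∀ t > T, ∀ ψ : Euc N → ℝ, LocallyLipschitz ψ →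
      ¬ ∀ᵐ x : Euc N, ‖x‖ ≤ r → DifferentiableAt ℝ ψ x → ∀ q : Euc N, ‖q‖ ≤ K →
        fderiv ℝ ψ x q ≤ t * Lag H (x, q) + β - v x) :
    ∃ μ : Measure (Euc N × Euc N), MatherMeasure H μ ∧ β ≤ ∫ z, v z.1 ∂μ := by
  set X : Set (Euc N × Euc N) := Metric.closedBall 0 r ×ˢ Metric.closedBall 0 K with hX
  have hXc : IsCompact X := (isCompact_closedBall _ _).prod (isCompact_closedBall _ _)
  have : CompactSpace X := isCompact_iff_compactSpace.1 hXc
  have hL := hc.tonelli.continuous_lag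
  have hmem : ∀ x q : Euc N, (x, q) ∈ X ↔ ‖x‖ ≤ r ∧ ‖q‖ ≤ K := by
    intro x q; simp [hX]
  let res : (g : Euc N × Euc N → ℝ) → Continuous g → C(X, ℝ) := fun g hg =>
    ⟨fun z => g z, hg.comp continuous_subtype_val⟩
  set Lc : C(X, ℝ) := res (Lag H) hL with hLc
  set vc : C(X, ℝ) := res (fun z => v z.1) (hv.comp continuous_fst) with hvc
  let IsWeak : C(X, ℝ) → (Euc N → ℝ) → ℝ → Prop := fun Φ u η =>
    LocallyLipschitz u ∧ ∀ᵐ x : Euc N, DifferentiableAt ℝ u x → ∀ (q : Euc N) (h : (x, q) ∈ X),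
      fderiv ℝ u x q + η ≤ Φ ⟨(x, q), h⟩
  set S : Set C(X, ℝ) := {Φ | ∃ u, ∃ η > 0, IsWeak Φ u η} with hS
  set D : Set C(X, ℝ) := {Φ | ∃ t > T, Φ = t • Lc + (β • (1 : C(X, ℝ)) - vc)} with hD
  have hScone : ∀ Φ ∈ S, ∀ s > (0 : ℝ), s • Φ ∈ S := by
    rintro Φ ⟨u, η, hη, hu, hae⟩ s hs
    refine ⟨fun x => s * u x, s * η, mul_pos hs hη, hu.const_mul_real s, ?_⟩
    filter_upwards [hae, hu.ae_differentiableAt_euc] with x hx du _ q h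
    rw [fderiv_const_mul du]
    have := mul_le_mul_of_nonneg_left (hx du q h) hs.le
    simp only [FunLike.coe_smul, Pi.smul_apply, ContinuousMap.smul_apply, smul_eq_mul]
    linarith
  have hSadd : ∀ Φ ∈ S, ∀ Ψ ∈ S, Φ + Ψ ∈ S := by
    rintro Φ ⟨u, η, hη, hu, hae⟩ Ψ ⟨w, η', hη', hw, hae'⟩
    refine ⟨fun x => u x + w x, η + η', add_pos hη hη', hu.add hw, ?_⟩
    filter_upwards [hae, hae', hu.ae_differentiableAt_euc, hw.ae_differentiableAt_euc]
      with x hx hx' du dw _ q h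
    rw [fderiv_fun_add du dw]
    have h1 := hx du q h
    have h2 := hx' dw q h
    simp only [FunLike.coe_add, Pi.add_apply, ContinuousMap.add_apply]
    linarith
  have hSconv : Convex ℝ S := by
    rw [convex_iff_forall_pos]
    intro Φ hΦ Ψ hΨ a b ha hb _
    exact hSadd _ (hScone Φ hΦ a ha) _ (hScone Ψ hΨ b hb)
  have hSopen : IsOpen S := by
    rw [Metric.isOpen_iff]
    rintro Φ ⟨u, η, hη, hu, hae⟩
    refine ⟨η / 2, by linarith, fun Ψ hΨ => ⟨u, η / 2, by linarith, hu, ?_⟩⟩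
    filter_upwards [hae] with x hx du q h
    have h1 := hx du q h
    have h2 := (ContinuousMap.dist_apply_le_dist (f := Ψ) (g := Φ) ⟨(x, q), h⟩).trans_lt hΨ
    rw [Real.dist_eq, abs_lt] at h2
    linarith [h2.1]
  have hDconv : Convex ℝ D := by
    rintro _ ⟨t, ht, rfl⟩ _ ⟨t', ht', rfl⟩ a b ha hb hab
    refine ⟨a * t + b * t', ?_, ?_⟩
    · have : a • t + b • t' ∈ Ioi T := convex_Ioi T ht ht' ha hb hab
      simpa using this
    · have hb' : b = 1 - a := by linarith
      subst hb'
      module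
  have hdisj : Disjoint S D := by
    rw [Set.disjoint_left]
    rintro Φ ⟨u, η, hη, hu, hae⟩ ⟨t, ht, hΦ⟩
    refine hno t ht u hu ?_
    filter_upwards [hae] with x hx hxr du q hq
    have h1 := hx du q ((hmem x q).2 ⟨hxr, hq⟩)
    rw [hΦ] at h1
    simp only [hLc, hvc, res, ContinuousMap.add_apply, ContinuousMap.smul_apply,
      ContinuousMap.sub_apply, ContinuousMap.one_apply, ContinuousMap.coe_mk, smul_eq_mul] at h1
    linarith
  obtain ⟨f, c, hfS, hfD⟩ := geometric_hahn_banach_open hSconv hSopen hDconv hdisj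
  have hSone : (1 : C(X, ℝ)) ∈ S :=
    ⟨fun _ => 0, 1, one_pos, LocallyLipschitz.const 0, Eventually.of_forall fun x _ q h => by simp⟩
  have hc0 : 0 ≤ c := by
    by_contra! hneg
    have h1 := hfS 1 hSone
    have hf1 : f 1 < 0 := h1.trans hneg
    have h2 := hfS _ (hScone 1 hSone (c / f 1) (div_pos_of_neg_of_neg hneg hf1))
    rw [map_smul, smul_eq_mul, div_mul_cancel₀ _ hf1.ne] at h2
    exact lt_irrefl _ h2
  have hfneg : ∀ Φ ∈ S, f Φ ≤ 0 := by
    intro Φ hΦ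
    by_contra! hp
    have h2 := hfS _ (hScone Φ hΦ ((c + 1) / f Φ) (by positivity))
    rw [map_smul, smul_eq_mul, div_mul_cancel₀ _ hp.ne'] at h2
    linarith
  have hweak : ∀ Φ : C(X, ℝ), (∃ u, IsWeak Φ u 0) → f Φ ≤ 0 := by
    rintro Φ ⟨u, hu, hae⟩
    have hη : ∀ η > (0 : ℝ), f Φ + η * f 1 ≤ 0 := by
      intro η hη
      have := hfneg (Φ + η • 1) ⟨u, η, hη, hu, by
        filter_upwards [hae] with x hx du q h
        have := hx du q h
        simp only [ContinuousMap.add_apply, ContinuousMap.smul_apply, ContinuousMap.one_apply,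
          smul_eq_mul, mul_one]
        linarith⟩
      rwa [map_add, map_smul, smul_eq_mul] at this
    have hlim : Tendsto (fun η : ℝ => f Φ + η * f 1) (𝓝[>] 0) (𝓝 (f Φ + 0 * f 1)) :=
      (Continuous.tendsto (by fun_prop) 0).mono_left nhdsWithin_le_nhds
    have := le_of_tendsto hlim (by
      filter_upwards [self_mem_nhdsWithin] with η h' using hη η h')
    simpa using this
  have hnonneg : ∀ Φ : C(X, ℝ), (∀ z, 0 ≤ Φ z) → f Φ ≤ 0 := fun Φ hΦ =>
    hweak Φ ⟨fun _ => 0, LocallyLipschitz.const 0,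
      Eventually.of_forall fun x _ q h => by simpa using hΦ _⟩
  have hf1 : f 1 < 0 := by
    refine lt_of_le_of_ne (hfneg 1 hSone) fun h0 => ?_
    set d : C(X, ℝ) := (T + 1) • Lc + (β • (1 : C(X, ℝ)) - vc)
    have hd := hfD d ⟨T + 1, by simp, rfl⟩
    have h1 := hfS 1 hSone
    have h2 := hnonneg (‖d‖ • (1 : C(X, ℝ)) + d) fun z => by
      have := (abs_le.1 (d.norm_coe_le_norm z)).1
      simp only [ContinuousMap.add_apply, ContinuousMap.smul_apply, ContinuousMap.one_apply,
        smul_eq_mul, mul_one]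
      linarith
    rw [map_add, map_smul, h0, smul_zero, zero_add] at h2
    linarith
  have hfd : ∀ t > T, 0 ≤ t * f Lc + (β * f 1 - f vc) := by
    intro t ht
    have := hc0.trans (hfD _ ⟨t, ht, rfl⟩)
    rwa [map_add, map_smul, map_sub, map_smul, smul_eq_mul, smul_eq_mul] at this
  have hfL : f Lc ≤ 0 := by
    obtain ⟨u, hu⟩ := hc.exists_critical_subsol
    refine hweak Lc ⟨u, hu.1, ?_⟩
    filter_upwards [hu.2] with x hx du q h
    have := hc.tonelli.inner_le x (gradient u x) q
    rw [inner_gradient] at this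
    simp only [hLc, res, ContinuousMap.coe_mk]
    linarith [hx du]
  have hfL0 : f Lc = 0 := by
    refine le_antisymm hfL ?_
    by_contra! hneg
    set B := β * f 1 - f vc
    have := hfd (max (T + 1) ((B + 1) / (-f Lc))) (lt_max_of_lt_left (by linarith))
    have h2 : (B + 1) / (-f Lc) * (-f Lc) = B + 1 := div_mul_cancel₀ _ (by linarith)
    have h3 : (B + 1) / (-f Lc) * (-f Lc) ≤ max (T + 1) ((B + 1) / (-f Lc)) * (-f Lc) :=
      mul_le_mul_of_nonneg_right (le_max_right _ _) (by linarith)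
    linarith
  have hfv : f vc ≤ β * f 1 := by
    have := hfd (T + 1) (by simp)
    rw [hfL0] at this
    linarith
  obtain ⟨μ₀, hμ₀, hintg₀⟩ := exists_probabilityMeasure_of_positive
    ((f 1)⁻¹ • (f : C(X, ℝ) →ₗ[ℝ] ℝ)) (by simp [hf1.ne])
    (fun Φ hΦ => by
      have := hnonneg Φ hΦ
      simp only [LinearMap.smul_apply, ContinuousLinearMap.coe_coe, smul_eq_mul]
      exact mul_nonneg_of_nonpos_of_nonpos (inv_nonpos.2 hf1.le) this)
  have hval : MeasurableEmbedding (Subtype.val : X → Euc N × Euc N) :=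
    MeasurableEmbedding.subtype_coe hXc.measurableSet
  have hintg : ∀ (g : Euc N × Euc N → ℝ) (hg : Continuous g),
      ∫ z, g z ∂(μ₀.map Subtype.val) = (f 1)⁻¹ * f (res g hg) := by
    intro g hg
    rw [hval.integral_map]
    exact hintg₀ (res g hg)
  refine ⟨μ₀.map Subtype.val, ⟨Measure.isProbabilityMeasure_map hval.measurable.aemeasurable,
    ?_, ?_, ?_⟩, ?_⟩
  · rw [hval.integrable_map_iff]
    exact Integrable.of_bound (Lc.continuous.aestronglyMeasurable) ‖Lc‖
      (Eventually.of_forall fun z => Lc.norm_coe_le_norm z)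
  · rw [hintg _ hL]
    exact mul_eq_zero_of_right _ hfL0
  · rintro Φ hΦ - ⟨u, hu, hae⟩ -
    rw [hintg Φ hΦ]
    refine mul_nonneg_of_nonpos_of_nonpos (inv_nonpos.2 hf1.le) (hweak _ ⟨u, hu, ?_⟩)
    filter_upwards [hae] with x hx du q h
    rw [add_zero]
    exact hx du q
  · rw [hintg (fun z => v z.1) (hv.comp continuous_fst)]
    rw [inv_mul_eq_div, le_div_iff_of_neg hf1]
    exact hfv

end Duality

section Convergence

variable {N : ℕ} {H : Euc N × Euc N → ℝ} {ε R m : ℝ}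

/-- A bounded critical subsolution `v` whose Mather averages are nonpositive admits a corrector:
a bounded `Ψ` whose gradient satisfies `H ≤ (δ - v) / t` for some `t > 0`. -/
theorem IsCritical.exists_corrector (hc : IsCritical H ε R m) {v : Euc N → ℝ}
    (hv : Continuous v) {M δ : ℝ} (hM : ∀ x, |v x| ≤ M)
    (hμ : ∀ μ : Measure (Euc N × Euc N), MatherMeasure H μ → ∫ z, v z.1 ∂μ ≤ 0) (hδ : 0 < δ) :
    ∃ t > 0, ∃ (Ψ : Euc N → ℝ) (B : ℝ), LocallyLipschitz Ψ ∧ (∀ x, |Ψ x| ≤ B) ∧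
      ∀ᵐ x : Euc N, DifferentiableAt ℝ Ψ x → H (x, gradient Ψ x) ≤ t⁻¹ * (δ - v x) := by
  have hH := hc.tonelli
  have hm := hc.level_neg
  have hR := hc.radius_nonneg
  have hε := hc.eps_pos
  have hM0 : 0 ≤ M := (abs_nonneg _).trans (hM 0)
  obtain ⟨C₀, hC₀, hC⟩ := hH.exists_lag_bound (R + 1) 1
  set C₁ := C₀ + 1 with hC₁
  set R' := max (R + (2 * C₁ * R) / ε) (R + 1) with hR'
  obtain ⟨K, hK⟩ := hH.exists_dual_test R' 1
  set c := min 1 (-m) with hcdef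
  have hc0 : 0 < c := lt_min one_pos (by linarith)
  set T := (δ + M) / c with hT
  have hT0 : 0 < T := by positivity
  obtain ⟨t, ht, ψ, hψ, hae⟩ : ∃ t > T, ∃ ψ : Euc N → ℝ, LocallyLipschitz ψ ∧
      ∀ᵐ x : Euc N, ‖x‖ ≤ R' → DifferentiableAt ℝ ψ x → ∀ q : Euc N, ‖q‖ ≤ max K 1 →
        fderiv ℝ ψ x q ≤ t * Lag H (x, q) + δ - v x := by
    by_contra hno
    obtain ⟨μ, hm1, hm2⟩ := hc.exists_matherMeasure hv R' (max K 1) δ T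
      (fun t ht ψ hψ h => hno ⟨t, ht, ψ, hψ, h⟩)
    linarith [hμ μ hm1]
  have ht0 : 0 < t := hT0.trans ht
  have hti : 0 < t⁻¹ := inv_pos.2 ht0
  have hg : ∀ x, |t⁻¹ * (δ - v x)| ≤ c := by
    intro x
    rw [abs_mul, abs_of_pos hti, inv_mul_le_iff₀ ht0]
    have h1 : |δ - v x| ≤ δ + M := by
      have := abs_le.1 (hM x)
      exact abs_le.2 ⟨by linarith, by linarith⟩
    have h2 : T * c = δ + M := div_mul_cancel₀ _ hc0.ne'
    nlinarith
  have hg1 : ∀ x, t⁻¹ * (δ - v x) ≤ 1 := fun x =>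
    (le_abs_self _).trans ((hg x).trans (min_le_left _ _))
  have hgm : ∀ x, m ≤ t⁻¹ * (δ - v x) := fun x => by
    have h1 := (abs_le.1 (hg x)).1
    have h2 : c ≤ -m := min_le_right _ _
    linarith
  set φ : Euc N → ℝ := fun x => t⁻¹ * ψ x with hφdef
  have hφ : LocallyLipschitz φ := hψ.const_mul_real t⁻¹
  have hφae : ∀ᵐ x : Euc N, ‖x‖ ≤ R' → DifferentiableAt ℝ φ x → ∀ q : Euc N, ‖q‖ ≤ max K 1 →
      fderiv ℝ φ x q ≤ Lag H (x, q) + t⁻¹ * (δ - v x) := by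
    filter_upwards [hae, hψ.ae_differentiableAt_euc] with x hx du hxR _ q hq
    have h1 := mul_le_mul_of_nonneg_left (hx hxR du q hq) hti.le
    have h2 : fderiv ℝ φ x = t⁻¹ • fderiv ℝ ψ x := by
      rw [hφdef]
      exact fderiv_const_mul du t⁻¹
    have h3 : t⁻¹ * (t * Lag H (x, q) + δ - v x) = Lag H (x, q) + t⁻¹ * (δ - v x) := by
      field_simp
      ring
    rw [h2]
    simpa [h3] using h1
  have hφH : ∀ᵐ x : Euc N, ‖x‖ ≤ R' → DifferentiableAt ℝ φ x →
      H (x, gradient φ x) ≤ t⁻¹ * (δ - v x) := by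
    filter_upwards [hφae] with x hx hxR du
    refine hK x _ hxR _ (hg1 x) fun q hq => ?_
    rw [inner_gradient]
    exact hx hxR du q (hq.trans (le_max_left _ _))
  have hlip : ∀ x y : Euc N, ‖x‖ ≤ R → ‖y‖ ≤ R → |φ x - φ y| ≤ C₁ * ‖x - y‖ := by
    intro x y hx hy
    refine abs_sub_le_of_segment (R := R) (fun x q s hs hq hseg => ?_) hx hy
    refine hφ.segment_le Metric.isOpen_ball (U := Metric.ball 0 (R + 1)) hs
      (fun s' hs' => ?_) ?_
    · have := hseg s' hs'
      simp only [Metric.mem_ball, dist_zero_right]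
      linarith
    · filter_upwards [hφae] with y hy hyU du
      have hyn : ‖y‖ ≤ R + 1 := by
        simp only [Metric.mem_ball, dist_zero_right] at hyU
        exact hyU.le
      have := hy (hyn.trans (le_max_right _ _)) du q (hq.trans (le_max_right _ _))
      linarith [hC y q hyn hq, hg1 y]
  obtain ⟨Ψ, hΨl, -, hΨb, hΨ, -⟩ := hc.exists_clamp hφ le_rfl (a := φ 0 - C₁ * R)
    (b := φ 0 + C₁ * R) (fun x hx => by
      have h1 := abs_le.1 (hlip x 0 hx (by simpa using hR))
      have h2 : C₁ * ‖x - 0‖ ≤ C₁ * R := by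
        rw [sub_zero]
        exact mul_le_mul_of_nonneg_left hx (by positivity)
      exact ⟨by linarith, by linarith⟩) hgm (by
      filter_upwards [hφH] with x hx hxR du
      refine hx (hxR.trans (le_trans (le_of_eq ?_) (le_max_left _ _))) du
      ring)
  refine ⟨t, ht0, Ψ, |φ 0| + C₁ * R, hΨl, fun x => ?_, hΨ⟩
  have h1 := hΨb x
  have h2 := abs_le.1 (le_refl |φ 0|)
  exact abs_le.2 ⟨by linarith, by linarith⟩

/-- Critical subsolutions with nonpositive Mather averages are approximated from below, locally
uniformly, by discounted subsolutions. -/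
theorem IsCritical.eventually_exists_disc_ge (hc : IsCritical H ε R m) {v : Euc N → ℝ}
    (hv : IsSubsol H 0 v)
    (hμ : ∀ μ : Measure (Euc N × Euc N), MatherMeasure H μ → ∫ z, v z.1 ∂μ ≤ 0)
    (r : ℝ) {δ : ℝ} (hδ : 0 < δ) :
    ∀ᶠ lam in 𝓝[>] (0 : ℝ), ∃ U : Euc N → ℝ, IsDiscSubsol H lam U ∧
      ∀ x, ‖x‖ ≤ r → v x - δ ≤ U x := by
  have hH := hc.tonelli
  obtain ⟨R₁, hR₁⟩ := hc.exists_mather_radius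
  set R₀ := max R (max R₁ r) with hR₀
  obtain ⟨M, hM⟩ := (isCompact_closedBall (0 : Euc N) R₀).exists_bound_of_continuousOn
    hv.1.continuous.continuousOn
  obtain ⟨u, hul, hueq, hub, hu, -⟩ := hc.exists_clamp hv.1 (R₀ := R₀) (le_max_left _ _)
    (a := -M) (b := M) (fun x hx => abs_le.1 (hM x (by simpa using hx))) (g := fun _ => 0)
    (fun _ => hc.level_neg.le) (by filter_upwards [hv.2] with x hx _ using hx)
  have huM : ∀ x, |u x| ≤ M := fun x => abs_le.2 (hub x)
  have huμ : ∀ μ : Measure (Euc N × Euc N), MatherMeasure H μ → ∫ z, u z.1 ∂μ ≤ 0 := by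
    intro μ h
    have : ∫ z, u z.1 ∂μ = ∫ z, v z.1 ∂μ := integral_congr_ae (by
      filter_upwards [hR₁ μ h] with z hz
      exact hueq _ (hz.trans ((le_max_left _ _).trans (le_max_right _ _))))
    exact this.trans_le (hμ μ h)
  obtain ⟨t, ht, Ψ, B, hΨl, hB, hΨ⟩ := hc.exists_corrector hul.continuous huM huμ
    (δ := δ / 4) (by positivity)
  have hlim : ∀ C : ℝ, Tendsto (fun lam : ℝ => lam * t * C) (𝓝[>] 0) (𝓝 0) := fun C =>
    tendsto_nhdsWithin_of_tendsto_nhds (Continuous.tendsto' (by fun_prop) 0 0 (by simp))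
  filter_upwards [self_mem_nhdsWithin, (hlim 1).eventually_le_const one_pos,
    (hlim (B + M)).eventually_le_const (show (0 : ℝ) < δ / 4 by positivity)] with lam hlam h1 h2
  have hlam : 0 < lam := hlam
  set θ := lam * t with hθ
  have hθ0 : 0 ≤ θ := by positivity
  rw [mul_one] at h1
  have hdiff : ∀ x, |θ * (Ψ x - u x)| ≤ δ / 4 := by
    intro x
    rw [abs_mul, abs_of_nonneg hθ0]
    refine le_trans (mul_le_mul_of_nonneg_left ?_ hθ0) h2
    exact (abs_sub _ _).trans (add_le_add (hB x) (huM x))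
  refine ⟨fun x => ((1 - θ) * u x + θ * Ψ x) - δ / 2, ⟨?_, ?_⟩, fun x hx => ?_⟩
  · have := ((hul.const_mul_real (1 - θ)).add (hΨl.const_mul_real θ)).sub
      (LocallyLipschitz.const (δ / 2))
    exact this
  · filter_upwards [hu, hΨ, hul.ae_differentiableAt_euc, hΨl.ae_differentiableAt_euc]
      with x hux hΨx du dΨ _
    have hgrad : gradient (fun x => ((1 - θ) * u x + θ * Ψ x) - δ / 2) x =
        (1 - θ) • gradient u x + θ • gradient Ψ x := by
      have : HasFDerivAt (fun x => ((1 - θ) * u x + θ * Ψ x) - δ / 2)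
          ((1 - θ) • fderiv ℝ u x + θ • fderiv ℝ Ψ x) x :=
        ((du.hasFDerivAt.const_mul (1 - θ)).add (dΨ.hasFDerivAt.const_mul θ)).sub_const _
      simp [gradient, this.fderiv]
    have hconv := (hH.convex x).2 (mem_univ (gradient u x)) (mem_univ (gradient Ψ x))
      (show 0 ≤ 1 - θ by linarith) hθ0 (by ring)
    simp only [smul_eq_mul] at hconv
    rw [hgrad]
    have h3 : (1 - θ) * H (x, gradient u x) ≤ 0 :=
      mul_nonpos_of_nonneg_of_nonpos (by linarith) (hux du)
    have h4 : θ * H (x, gradient Ψ x) ≤ lam * (δ / 4 - u x) := by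
      refine (mul_le_mul_of_nonneg_left (hΨx dΨ) hθ0).trans (le_of_eq ?_)
      rw [hθ]
      field_simp
    have h5 := mul_le_mul_of_nonneg_left (abs_le.1 (hdiff x)).2 hlam.le
    linarith
  · have h3 := hueq x (hx.trans ((le_max_right _ _).trans (le_max_right _ _)))
    have h4 := (abs_le.1 (hdiff x)).1
    linarith

end Convergence

section Main

variable {N : ℕ} {H : Euc N × Euc N → ℝ} {ε R m : ℝ}

/-- Critical subsolutions whose averages against all Mather measures are nonpositive. -/
def IsAdmissible (H : Euc N × Euc N → ℝ) (v : Euc N → ℝ) : Prop :=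
  IsSubsol H 0 v ∧
    ∀ μ : Measure (Euc N × Euc N), MatherMeasure H μ → ∫ z, v z.1 ∂μ ≤ 0

theorem IsTonelli.exists_isCritical (hH : IsTonelli H)
    (hA3 : ∃ ε > (0 : ℝ), ∃ m : ℝ,
      (∃ R : ℝ, ∀ x : Euc N, R ≤ ‖x‖ → ∀ p : Euc N, ‖p‖ ≤ ε → H (x, p) ≤ m) ∧
      (∃ x₀ : Euc N, ∀ p : Euc N, m < H (x₀, p)))
    (hcrit : sInf {a : ℝ | ∃ u : Euc N → ℝ, IsSubsol H a u} = 0) :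
    ∃ ε R m : ℝ, IsCritical H ε R m := by
  obtain ⟨ε, hε, m, ⟨R, hR⟩, x₀, hx₀⟩ := hA3
  have hcont := hH.continuous
  obtain ⟨p₀, hp₀⟩ : ∃ p₀, ∀ p, H (x₀, p₀) ≤ H (x₀, p) := by
    refine Continuous.exists_forall_le (by fun_prop) ?_
    obtain ⟨r, hr⟩ := hH.superlinear x₀ 1
    have hnorm := tendsto_norm_cocompact_atTop (E := Euc N)
    refine tendsto_atTop_mono' _ ?_ hnorm
    filter_upwards [hnorm.eventually_ge_atTop r] with p hp
    simpa using hr p hp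
  have hlow : ∀ (a : ℝ) (u : Euc N → ℝ), IsSubsol H a u → H (x₀, p₀) ≤ a := by
    intro a u hu
    have h1 := hu.segSub hH x₀ 0 1 (Lag H (x₀, 0) + a) zero_le_one (fun s _ => by simp)
    have h2 : Lag H (x₀, 0) ≤ -H (x₀, p₀) := IsTonelli.lag_le x₀ 0 fun p => by
      simpa using hp₀ p
    simp only [smul_zero, add_zero] at h1
    linarith
  have hne : {a : ℝ | ∃ u : Euc N → ℝ, IsSubsol H a u}.Nonempty := by
    obtain ⟨M, hM⟩ := hH.exists_bound R 0
    refine ⟨max M m, fun _ => 0, LocallyLipschitz.const 0, Eventually.of_forall fun x _ => ?_⟩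
    rw [gradient_zero_of_eventually_eq_const (b := 0) (Eventually.of_forall fun _ => rfl)]
    rcases le_total ‖x‖ R with h | h
    · exact ((le_abs_self _).trans (hM x 0 h (by simp))).trans (le_max_left _ _)
    · exact (hR x h 0 (by simpa using hε.le)).trans (le_max_right _ _)
  have hbdd : BddBelow {a : ℝ | ∃ u : Euc N → ℝ, IsSubsol H a u} :=
    ⟨H (x₀, p₀), by rintro a ⟨u, hu⟩; exact hlow a u hu⟩
  refine ⟨ε, max R 0, m, hH, hε, le_max_right _ _, ?_, ?_, ?_, ?_⟩
  · refine (hx₀ p₀).trans_le ?_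
    rw [← hcrit]
    exact le_csInf hne (by rintro a ⟨u, hu⟩; exact hlow a u hu)
  · exact fun x p hx hp => hR x ((le_max_left _ _).trans hx) p hp
  · intro a u hu
    rw [← hcrit]
    exact csInf_le hbdd ⟨u, hu⟩
  · intro a ha
    obtain ⟨b, ⟨u, hu⟩, hb⟩ := exists_lt_of_csInf_lt hne (hcrit.trans_lt ha)
    exact ⟨u, hu.1, by filter_upwards [hu.2] with x hx hd using (hx hd).trans hb.le⟩

theorem IsCritical.exists_nonpos_subsol (hc : IsCritical H ε R m) :
    ∃ v : Euc N → ℝ, IsSubsol H 0 v ∧ ∀ x, v x ≤ 0 := by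
  obtain ⟨v, M, -, hv, hM, -⟩ := hc.exists_bounded_critical_subsol
  exact ⟨fun x => v x - M, hv.sub_const hc.tonelli M, fun x => by
    linarith [(abs_le.1 (hM x)).2]⟩

theorem IsCritical.exists_isAdmissible (hc : IsCritical H ε R m) :
    ∃ v : Euc N → ℝ, IsAdmissible H v := by
  obtain ⟨v, hv, h0⟩ := hc.exists_nonpos_subsol
  exact ⟨v, hv, fun μ _ => integral_nonpos fun z => h0 z.1⟩

theorem IsCritical.exists_isAdmissible_bound (hc : IsCritical H ε R m) (r : ℝ) :
    ∃ C : ℝ, ∀ v : Euc N → ℝ, IsAdmissible H v → ∀ x, ‖x‖ ≤ r → v x ≤ C := by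
  obtain ⟨C, hC⟩ := hc.exists_disc_bound r
  refine ⟨C + 1, fun v hv x hx => ?_⟩
  obtain ⟨lam, ⟨U, hU, hle⟩, h0, h1⟩ := ((hc.eventually_exists_disc_ge hv.1 hv.2 r one_pos).and
    (Ioc_mem_nhdsGT (zero_lt_one' ℝ))).exists
  linarith [hC lam h0 h1 U hU x hx, hle x hx]

/-- Discounted subsolutions with a common lower bound converge, along an ultrafilter of vanishing
discounts, locally uniformly to an admissible critical subsolution. -/
theorem IsCritical.exists_isAdmissible_limit (hc : IsCritical H ε R m) {𝒰 : Ultrafilter ℝ}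
    (h𝒰 : (𝒰 : Filter ℝ) ≤ 𝓝[>] 0) {v : ℝ → Euc N → ℝ} {M : ℝ} (hM0 : 0 ≤ M)
    (hv : ∀ᶠ lam in (𝒰 : Filter ℝ), IsDiscSubsol H lam (v lam) ∧ ∀ x, -M ≤ v lam x) :
    ∃ V : Euc N → ℝ, IsAdmissible H V ∧ ∀ r η : ℝ, 0 < η →
      ∀ᶠ lam in (𝒰 : Filter ℝ), ∀ x, ‖x‖ ≤ r → |v lam x - V x| ≤ η := by
  have hH := hc.tonelli
  have hsmall : ∀ᶠ lam in (𝒰 : Filter ℝ), 0 < lam ∧ lam ≤ 1 :=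
    h𝒰 (Ioc_mem_nhdsGT zero_lt_one)
  have hseg : ∀ᶠ lam in (𝒰 : Filter ℝ), SegSub (fun z => Lag H z + lam * M) (v lam) := by
    filter_upwards [hv, hsmall] with lam h1 h2 using h1.1.segSub hH h2.1.le h1.2
  obtain ⟨V, hlim, hVseg⟩ := exists_limit_segSub (h𝒰.trans nhdsWithin_le_nhds) hseg fun x => by
    obtain ⟨C, hC⟩ := hc.exists_disc_bound ‖x‖
    refine ⟨max M C, ?_⟩
    filter_upwards [hv, hsmall] with lam h1 h2
    exact abs_le.2 ⟨by linarith [h1.2 x, le_max_left M C],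
      (hC lam h2.1 h2.2 _ h1.1 x le_rfl).trans (le_max_right _ _)⟩
  have hV : IsSubsol H 0 V := SegSub.isSubsol hH (by simpa using hVseg)
  have hunif : ∀ r η : ℝ, 0 < η →
      ∀ᶠ lam in (𝒰 : Filter ℝ), ∀ x, ‖x‖ ≤ r → |v lam x - V x| ≤ η := by
    intro r η hη
    obtain ⟨C, hC0, hC⟩ := hH.exists_lipschitz r M
    obtain ⟨s, hs, hsfin, hcov⟩ := (isCompact_closedBall (0 : Euc N) r).finite_cover_balls
      (e := η / (4 * (C + 1))) (by positivity)
    have hpt : ∀ᶠ lam in (𝒰 : Filter ℝ), ∀ y ∈ s, |v lam y - V y| < η / 2 := by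
      rw [eventually_all_finite hsfin]
      intro y _
      filter_upwards [Metric.tendsto_nhds.1 (hlim y) (η / 2) (by positivity)] with lam h
      rwa [Real.dist_eq] at h
    filter_upwards [hpt, hseg, hsmall] with lam h1 h2 h3 x hx
    obtain ⟨y, hy, hxy⟩ := mem_iUnion₂.1 (hcov (by simpa using hx))
    have hyr : ‖y‖ ≤ r := by simpa using hs hy
    rw [Metric.mem_ball, dist_eq_norm] at hxy
    have hCe : C * ‖x - y‖ ≤ η / 4 := by
      have h4 : (C + 1) * ‖x - y‖ ≤ (C + 1) * (η / (4 * (C + 1))) :=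
        mul_le_mul_of_nonneg_left hxy.le (by positivity)
      have h5 : (C + 1) * (η / (4 * (C + 1))) = η / 4 := by field_simp
      linarith [norm_nonneg (x - y)]
    have h6 := abs_le.1 ((hC (v lam) _ (mul_le_of_le_one_left hM0 h3.2) h2 x y hx hyr).trans hCe)
    have h7 := abs_le.1 ((hC V 0 hM0 (by simpa using hVseg) x y hx hyr).trans hCe)
    have h8 := abs_lt.1 (h1 y hy)
    exact abs_le.2 ⟨by linarith, by linarith⟩
  refine ⟨V, ⟨hV, fun μ hμ => ?_⟩, hunif⟩
  obtain ⟨R₁, hR₁⟩ := hc.exists_mather_radius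
  have hsupp := hR₁ μ hμ
  have := hμ.1
  refine le_of_forall_pos_le_add fun η hη => ?_
  obtain ⟨lam, h1, h2, h3⟩ := ((hunif R₁ η hη).and (hv.and hsmall)).exists
  have hintg := integrable_fst_of_ae_ball hsupp h2.1.1.continuous
  calc ∫ z, V z.1 ∂μ ≤ ∫ z, (v lam z.1 + η) ∂μ := by
        refine integral_mono_ae (integrable_fst_of_ae_ball hsupp hV.1.continuous)
          (hintg.add (integrable_const η)) ?_
        filter_upwards [hsupp] with z hz
        linarith [(abs_le.1 (h1 z.1 hz)).1]
    _ = ∫ z, v lam z.1 ∂μ + η := by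
        rw [integral_add hintg (integrable_const η)]
        simp
    _ ≤ 0 + η := by linarith [hc.integral_disc_nonpos h3.1 h2.1 hμ]

theorem IsCritical.eventually_le_add (hc : IsCritical H ε R m) {um : ℝ → Euc N → ℝ}
    (hum : ∀ lam : ℝ, 0 < lam → ∀ x : Euc N,
      um lam x = sSup {r : ℝ | ∃ v : Euc N → ℝ, IsDiscSubsol H lam v ∧ v x = r})
    {w : Euc N → ℝ} (hw : ∀ v : Euc N → ℝ, IsAdmissible H v → ∀ x, v x ≤ w x)
    (r : ℝ) {δ : ℝ} (hδ : 0 < δ) :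
    ∀ᶠ lam in 𝓝[>] (0 : ℝ), ∀ x, ‖x‖ ≤ r → um lam x ≤ w x + δ := by
  by_contra hcon
  have hne := frequently_iff_neBot.1 (not_eventually.1 hcon)
  set 𝒰 : Ultrafilter ℝ := @Ultrafilter.of ℝ _ hne with h𝒰
  have hle : (𝒰 : Filter ℝ) ≤ _ := @Ultrafilter.of_le ℝ _ hne
  have hpos : (𝒰 : Filter ℝ) ≤ 𝓝[>] 0 := hle.trans inf_le_left
  have hbad : ∀ᶠ lam in (𝒰 : Filter ℝ), ¬ ∀ x, ‖x‖ ≤ r → um lam x ≤ w x + δ :=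
    le_principal_iff.1 (hle.trans inf_le_right)
  obtain ⟨M, hM0, hraise⟩ := hc.exists_raise
  obtain ⟨v₀, hv₀, hv₀n⟩ := hc.exists_nonpos_subsol
  have hex : ∀ lam : ℝ, ∃ v : Euc N → ℝ,
      0 < lam ∧ (¬ ∀ x, ‖x‖ ≤ r → um lam x ≤ w x + δ) →
        (IsDiscSubsol H lam v ∧ ∀ x, -M ≤ v x) ∧ ∃ x, ‖x‖ ≤ r ∧ w x + δ < v x := by
    intro lam
    by_cases h : 0 < lam ∧ ¬ ∀ x, ‖x‖ ≤ r → um lam x ≤ w x + δ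
    · obtain ⟨hl, hb⟩ := h
      push Not at hb
      obtain ⟨x, hx, hlt⟩ := hb
      rw [hum lam hl] at hlt
      have hne : {r : ℝ | ∃ v : Euc N → ℝ, IsDiscSubsol H lam v ∧ v x = r}.Nonempty :=
        ⟨v₀ x, v₀, hv₀.isDiscSubsol hl.le hv₀n, rfl⟩
      obtain ⟨_, ⟨v, hv, rfl⟩, hvx⟩ := exists_lt_of_lt_csSup hne hlt
      obtain ⟨V, hV, hvV, hVM⟩ := hraise lam hl v hv
      exact ⟨V, fun _ => ⟨⟨hV, hVM⟩, x, hx, hvx.trans_le (hvV x)⟩⟩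
    · exact ⟨0, fun h' => absurd h' h⟩
  choose v hv using hex
  have hgood := (show ∀ᶠ lam in (𝒰 : Filter ℝ), 0 < lam from hpos self_mem_nhdsWithin).and hbad
  obtain ⟨V, hV, hlim⟩ := hc.exists_isAdmissible_limit hpos hM0
    (hgood.mono fun lam h => (hv lam h).1)
  obtain ⟨lam, h1, h2⟩ := ((hlim r (δ / 2) (by positivity)).and hgood).exists
  obtain ⟨x, hx, hlt⟩ := (hv lam h2).2
  linarith [(abs_le.1 (h1 x hx)).2, hw V hV x]

theorem IsCritical.eventually_sub_le (hc : IsCritical H ε R m) {um : ℝ → Euc N → ℝ}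
    (hum : ∀ lam : ℝ, 0 < lam → ∀ x : Euc N,
      um lam x = sSup {r : ℝ | ∃ v : Euc N → ℝ, IsDiscSubsol H lam v ∧ v x = r})
    {w : Euc N → ℝ} (hw : ∀ v : Euc N → ℝ, IsAdmissible H v → ∀ x, v x ≤ w x)
    (hwlt : ∀ x, ∀ a < w x, ∃ v : Euc N → ℝ, IsAdmissible H v ∧ a < v x)
    (r : ℝ) {δ : ℝ} (hδ : 0 < δ) :
    ∀ᶠ lam in 𝓝[>] (0 : ℝ), ∀ x, ‖x‖ ≤ r → w x - δ ≤ um lam x := by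
  have hH := hc.tonelli
  obtain ⟨C, hC0, hC⟩ := hH.exists_lipschitz r 0
  obtain ⟨B, hB⟩ := hc.exists_disc_bound r
  have hlip : ∀ v, IsAdmissible H v → ∀ x y : Euc N, ‖x‖ ≤ r → ‖y‖ ≤ r →
      v x ≤ v y + C * ‖x - y‖ := fun v hv x y hx hy => by
    linarith [(abs_le.1 (hC v 0 le_rfl (hv.1.segSub hH) x y hx hy)).2]
  have hwlip : ∀ x y : Euc N, ‖x‖ ≤ r → ‖y‖ ≤ r → w x ≤ w y + C * ‖x - y‖ := by
    intro x y hx hy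
    refine le_of_forall_lt fun a ha => ?_
    obtain ⟨v, hv, hav⟩ := hwlt x a ha
    linarith [hlip v hv x y hx hy, hw v hv y]
  obtain ⟨s, hs, hsfin, hcov⟩ := (isCompact_closedBall (0 : Euc N) r).finite_cover_balls
    (e := δ / (4 * (C + 1))) (by positivity)
  choose! v hv hvz using fun z => hwlt z (w z - δ / 4) (by linarith)
  have hev : ∀ᶠ lam in 𝓝[>] (0 : ℝ), ∀ z ∈ s, ∃ U : Euc N → ℝ, IsDiscSubsol H lam U ∧
      ∀ x, ‖x‖ ≤ r → v z x - δ / 4 ≤ U x := by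
    rw [eventually_all_finite hsfin]
    exact fun z _ => hc.eventually_exists_disc_ge (hv z).1 (hv z).2 r (by positivity)
  filter_upwards [hev, Ioc_mem_nhdsGT (zero_lt_one' ℝ)] with lam h1 h2 x hx
  obtain ⟨z, hz, hxz⟩ := mem_iUnion₂.1 (hcov (by simpa using hx))
  have hzr : ‖z‖ ≤ r := by simpa using hs hz
  rw [Metric.mem_ball, dist_eq_norm] at hxz
  have hCe : C * ‖x - z‖ ≤ δ / 4 := by
    have h4 : (C + 1) * ‖x - z‖ ≤ (C + 1) * (δ / (4 * (C + 1))) :=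
      mul_le_mul_of_nonneg_left hxz.le (by positivity)
    have h5 : (C + 1) * (δ / (4 * (C + 1))) = δ / 4 := by field_simp
    linarith [norm_nonneg (x - z)]
  obtain ⟨U, hU, hvU⟩ := h1 z hz
  have hUle : U x ≤ um lam x := by
    rw [hum lam h2.1]
    refine le_csSup ⟨B, ?_⟩ ⟨U, hU, rfl⟩
    rintro _ ⟨u, hu, rfl⟩
    exact hB lam h2.1 h2.2 u hu x hx
  have h6 := hlip (v z) (hv z) z x hzr hx
  rw [norm_sub_rev] at h6
  linarith [hwlip x z hx hzr, hvz z, hvU x hx]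

end Main

theorem stmt18 {N : ℕ} (hN : 1 ≤ N) (H : Euc N × Euc N → ℝ)
    (hA1 : Continuous H)
    (hA2conv : ∀ x : Euc N, ConvexOn ℝ Set.univ fun p => H (x, p))
    (hA2coer : ∀ R : ℝ, 0 < R → ∀ C : ℝ, ∃ r : ℝ, ∀ x p : Euc N,
      ‖x‖ ≤ R → r ≤ ‖p‖ → C ≤ H (x, p))
    (hA3 : ∃ ε > (0 : ℝ), ∃ m : ℝ,
      (∃ R : ℝ, ∀ x : Euc N, R ≤ ‖x‖ → ∀ p : Euc N, ‖p‖ ≤ ε → H (x, p) ≤ m) ∧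
      (∃ x₀ : Euc N, ∀ p : Euc N, m < H (x₀, p)))
    (hcrit : sInf {a : ℝ | ∃ u : Euc N → ℝ, IsSubsol H a u} = 0)
    (hsl : ∀ x : Euc N, ∀ C : ℝ, ∃ r : ℝ, ∀ p : Euc N, r ≤ ‖p‖ → C * ‖p‖ ≤ H (x, p))
    (um : ℝ → Euc N → ℝ)
    (hum : ∀ lam : ℝ, 0 < lam → ∀ x : Euc N,
      um lam x = sSup {r : ℝ | ∃ v : Euc N → ℝ, IsDiscSubsol H lam v ∧ v x = r})
    (w : Euc N → ℝ)
    (hw : ∀ x : Euc N, w x = sSup {r : ℝ | ∃ v : Euc N → ℝ, IsSubsol H 0 v ∧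
      (∀ μ : Measure (Euc N × Euc N), MatherMeasure H μ →
        (∫ p : Euc N × Euc N, v p.1 ∂μ) ≤ 0) ∧ v x = r}) :
    ∀ K : Set (Euc N), IsCompact K →
      TendstoUniformlyOn (fun lam : ℝ => um lam) w (nhdsWithin 0 (Set.Ioi 0)) K := by
  intro K hK
  obtain ⟨ε, R, m, hc⟩ := IsTonelli.exists_isCritical ⟨hA1, hA2conv, hsl⟩ hA3 hcrit
  have hle : ∀ v : Euc N → ℝ, IsAdmissible H v → ∀ x, v x ≤ w x := by
    intro v hv x
    obtain ⟨C, hC⟩ := hc.exists_isAdmissible_bound ‖x‖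
    rw [hw x]
    refine le_csSup ⟨C, ?_⟩ ⟨v, hv.1, hv.2, rfl⟩
    rintro _ ⟨u, hu, huμ, rfl⟩
    exact hC u ⟨hu, huμ⟩ x le_rfl
  have hlt : ∀ x, ∀ a < w x, ∃ v : Euc N → ℝ, IsAdmissible H v ∧ a < v x := by
    intro x a ha
    rw [hw x] at ha
    obtain ⟨v₀, hv₀⟩ := hc.exists_isAdmissible
    have hne : {r : ℝ | ∃ v : Euc N → ℝ, IsSubsol H 0 v ∧
        (∀ μ : Measure (Euc N × Euc N), MatherMeasure H μ →
          (∫ p : Euc N × Euc N, v p.1 ∂μ) ≤ 0) ∧ v x = r}.Nonempty :=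
      ⟨v₀ x, v₀, hv₀.1, hv₀.2, rfl⟩
    obtain ⟨_, ⟨v, hv, hvμ, rfl⟩, hav⟩ := exists_lt_of_lt_csSup hne ha
    exact ⟨v, ⟨hv, hvμ⟩, hav⟩
  obtain ⟨r, hr⟩ := hK.isBounded.exists_norm_le
  rw [Metric.tendstoUniformlyOn_iff]
  intro δ hδ
  filter_upwards [hc.eventually_le_add hum hle r (half_pos hδ),
    hc.eventually_sub_le hum hle hlt r (half_pos hδ)] with lam h1 h2 x hx
  rw [Real.dist_eq, abs_lt]
  constructor <;> linarith [h1 x (hr x hx), h2 x (hr x hx)]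

end
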